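/- Under the normalized setup with the quadratic asymptotic expansion, for every e ∈ E: sup_{ℝ^{n+1}_−} Δ_e²u = eᵀAe/|e|². -/

import Mathlib

open Set MeasureTheory

noncomputable section

abbrev En (n : ℕ) : Type := EuclideanSpace ℝ (Fin n)

namespace PMA

variable {n : ℕ}

/-- The lower half-space `ℝⁿ × (−∞,0]`. -/
def halfSpace (n : ℕ) : Set (En n × ℝ) := univ ×ˢ Iic (0:ℝ)

/-- The time derivative `u_t`. -/
def timeDeriv (u : En n → ℝ → ℝ) (x : En n) (t : ℝ) : ℝ := deriv (u x) t

/-- The spatial gradient `D_x u`. -/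
def spaceGrad (u : En n → ℝ → ℝ) (x : En n) (t : ℝ) : En n := gradient (fun y => u y t) x

/-- The spatial Hessian `D_x² u`, as an `n × n` matrix. -/
def spaceHess (u : En n → ℝ → ℝ) (x : En n) (t : ℝ) : Matrix (Fin n) (Fin n) ℝ :=
  fun i j => iteratedFDeriv ℝ 2 (fun y => u y t) x
    ![EuclideanSpace.single i 1, EuclideanSpace.single j 1]

/-- A function is parabolically convex on `D` if it is convex in `x` and nonincreasing in `t`. -/
def ParabolicallyConvexOn (D : Set (En n × ℝ)) (u : En n → ℝ → ℝ) : Prop :=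
  (∀ t : ℝ, ConvexOn ℝ {x | (x, t) ∈ D} (fun x => u x t)) ∧
  (∀ x : En n, ∀ s t : ℝ, s ≤ t → (x, s) ∈ D → (x, t) ∈ D → u x t ≤ u x s)

/-- The time slice `D(t)`. -/
def slice (D : Set (En n × ℝ)) (t : ℝ) : Set (En n) := {x | (x, t) ∈ D}

/-- Bowl-shaped domain. -/
def IsBowlShaped (D : Set (En n × ℝ)) : Prop :=
  D ⊆ halfSpace n ∧ (∀ t, Convex ℝ (slice D t)) ∧
  ∀ t₁ t₂ : ℝ, t₁ ≤ t₂ → (slice D t₂).Nonempty → slice D t₁ ⊆ slice D t₂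

/-- The parabolic boundary `∂_p D`. -/
def parabolicBoundary (D : Set (En n × ℝ)) : Set (En n × ℝ) :=
  (closure (slice D (sInf {t | (slice D t).Nonempty})) ×ˢ
      ({sInf {t | (slice D t).Nonempty}} : Set ℝ)) ∪
  ⋃ t ∈ Iic (0:ℝ), frontier (slice D t) ×ˢ ({t} : Set ℝ)

/-- Parabolic distance between two points. -/
def pdist (X Y : En n × ℝ) : ℝ := Real.sqrt (‖X.1 - Y.1‖^2 + |X.2 - Y.2|)

/-- Parabolic distance from a point to a set. -/
def pdistSet (Z : En n × ℝ) (S : Set (En n × ℝ)) : ℝ := sInf (pdist Z '' S)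

/-- `C^{2k,k}` regularity on a set: all mixed derivatives `D_x^i D_t^j u` with `i + 2j ≤ 2k`
exist and are continuous. -/
def IsC2kOn (k : ℕ) (u : En n → ℝ → ℝ) (D : Set (En n × ℝ)) : Prop :=
  ∀ i j : ℕ, i + 2*j ≤ 2*k →
    (∀ p ∈ D, ContDiffAt ℝ i (fun y => iteratedDeriv j (u y) p.2) p.1 ∧
      ContDiffAt ℝ j (u p.1) p.2) ∧
    ContinuousOn
      (fun p : En n × ℝ => iteratedFDeriv ℝ i (fun y => iteratedDeriv j (u y) p.2) p.1) D

/-- A matrix acting on `ℝⁿ`. -/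
def mApply (M : Matrix (Fin n) (Fin n) ℝ) (x : En n) : En n :=
  (WithLp.equiv 2 (Fin n → ℝ)).symm (M.mulVec (WithLp.equiv 2 (Fin n → ℝ) x))

/-- The quadratic form `xᵀ A x`. -/
def quadForm (A : Matrix (Fin n) (Fin n) ℝ) (x : En n) : ℝ := ∑ i, ∑ j, A i j * x i * x j

/-- The dot product `b · x` on `ℝⁿ`. -/
def dotp (b x : En n) : ℝ := ∑ i, b i * x i

/-- Second-order difference quotient `Δ_e² u`. -/
def sdq (u : En n → ℝ → ℝ) (e : En n) (x : En n) (t : ℝ) : ℝ :=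
  (u (x + e) t + u (x - e) t - 2 * u x t) / ‖e‖^2

end PMA

namespace PMA

open Matrix Filter Topology
open scoped RealInnerProductSpace ENNReal NNReal

variable {n : ℕ}

/-- Arithmetic–geometric mean inequality for a finite family. -/
lemma prod_le_sum_div_card_pow {ι : Type*} [Fintype ι] [Nonempty ι] (z : ι → ℝ)
    (hz : ∀ i, 0 ≤ z i) :
    ∏ i, z i ≤ ((∑ i, z i) / Fintype.card ι) ^ Fintype.card ι := by
  have hc : (0 : ℝ) < Fintype.card ι := by exact_mod_cast Fintype.card_pos
  have h := Real.geom_mean_le_arith_mean Finset.univ (fun _ : ι => (1 : ℝ)) z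
    (fun _ _ => zero_le_one) (by simpa using hc) (fun i _ => hz i)
  simp only [Real.rpow_one, Finset.sum_const, Finset.card_univ, nsmul_eq_mul, mul_one,
    one_mul] at h
  have hp : 0 ≤ ∏ i, z i := Finset.prod_nonneg fun i _ => hz i
  calc ∏ i, z i = ((∏ i, z i) ^ ((Fintype.card ι : ℝ))⁻¹) ^ Fintype.card ι := by
        rw [Real.rpow_inv_natCast_pow hp Fintype.card_ne_zero]
    _ ≤ _ := by gcongr

/-- The arithmetic–geometric mean inequality for the linearized parabolic Monge–Ampère operator. -/
lemma mul_det_le_of_posDef {n : ℕ} {N Z : Matrix (Fin n) (Fin n) ℝ} (hN : N.PosDef)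
    (hZ : Z.PosSemidef) {p ζ : ℝ} (hp : 0 < p) (hζ : 0 ≤ ζ) :
    ζ * Z.det ≤ (((N⁻¹ * Z).trace + ζ / p) / (n + 1)) ^ (n + 1) * (p * N.det) := by
  open scoped MatrixOrder in
  obtain ⟨B, hB⟩ := CStarAlgebra.nonneg_iff_eq_star_mul_self.mp hN.inv.posSemidef.nonneg
  rw [star_eq_conjTranspose] at hB
  have hW : (B * Z * Bᴴ).PosSemidef := hZ.mul_mul_conjTranspose_same B
  have htr : (N⁻¹ * Z).trace = (B * Z * Bᴴ).trace := by
    rw [hB, Matrix.trace_mul_comm (B * Z), ← Matrix.mul_assoc]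
  have hdN := hN.det_pos
  have hdet : Z.det = (B * Z * Bᴴ).det * N.det := by
    have h1 : B.det * Bᴴ.det = (N.det)⁻¹ := by
      rw [mul_comm, ← Matrix.det_mul, ← hB, Matrix.det_nonsing_inv, Ring.inverse_eq_inv']
    rw [Matrix.det_mul, Matrix.det_mul,
      show B.det * Z.det * Bᴴ.det * N.det = B.det * Bᴴ.det * N.det * Z.det by ring, h1,
      inv_mul_cancel₀ hdN.ne', one_mul]
  have hamgm := prod_le_sum_div_card_pow
    (fun o : Option (Fin n) => o.elim (ζ / p) hW.1.eigenvalues) (by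
      rintro (_ | i)
      · exact div_nonneg hζ hp.le
      · exact hW.eigenvalues_nonneg i)
  have e1 := hW.1.det_eq_prod_eigenvalues
  have e2 := hW.1.trace_eq_sum_eigenvalues
  simp only [RCLike.ofReal_real_eq_id, id] at e1 e2
  simp only [Fintype.prod_option, Fintype.sum_option, Option.elim, Fintype.card_option,
    Fintype.card_fin, ← e1, ← e2] at hamgm
  rw [← htr] at hamgm
  push_cast at hamgm
  rw [hdet]
  calc ζ * ((B * Z * Bᴴ).det * N.det) = (ζ / p * (B * Z * Bᴴ).det) * (p * N.det) := by
        field_simp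
    _ ≤ _ := by
        rw [add_comm (N⁻¹ * Z).trace]
        exact mul_le_mul_of_nonneg_right hamgm (by positivity)

lemma trace_inv_mul_nonneg {n : ℕ} {N Z : Matrix (Fin n) (Fin n) ℝ} (hN : N.PosDef)
    (hZ : Z.PosSemidef) : 0 ≤ (N⁻¹ * Z).trace := by
  open scoped MatrixOrder in
  obtain ⟨B, hB⟩ := CStarAlgebra.nonneg_iff_eq_star_mul_self.mp hN.inv.posSemidef.nonneg
  rw [hB, star_eq_conjTranspose, Matrix.mul_assoc, Matrix.trace_mul_comm]
  exact (hZ.mul_mul_conjTranspose_same B).trace_nonneg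

lemma mul_det_le_of_trace_le {n : ℕ} {N Z : Matrix (Fin n) (Fin n) ℝ} (hN : N.PosDef)
    (hZ : Z.PosSemidef) {p ζ κ : ℝ} (hp : 0 < p) (hζ : 0 ≤ ζ)
    (h : (N⁻¹ * Z).trace + ζ / p ≤ κ * (n + 1)) :
    ζ * Z.det ≤ κ ^ (n + 1) * (p * N.det) := by
  refine (mul_det_le_of_posDef hN hZ hp hζ).trans ?_
  have hdN := hN.det_pos
  have htr := trace_inv_mul_nonneg hN hZ
  gcongr
  rw [div_le_iff₀ (by positivity)]
  exact h

lemma le_trace_inv_mul_add_div {n : ℕ} {N N' : Matrix (Fin n) (Fin n) ℝ} (hN : N.PosDef)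
    (hN' : N'.PosDef) {p p' : ℝ} (hp : 0 < p) (hp' : 0 < p') (h : p' * N'.det = p * N.det) :
    (n : ℝ) + 1 ≤ (N⁻¹ * N').trace + p' / p := by
  have h1 := mul_det_le_of_posDef hN hN'.posSemidef hp hp'.le
  have hpos : 0 < p * N.det := mul_pos hp hN.det_pos
  rw [h] at h1
  by_contra! hlt
  have htr := trace_inv_mul_nonneg hN hN'.posSemidef
  have h2 : (((N⁻¹ * N').trace + p' / p) / (n + 1)) ^ (n + 1) < 1 := by
    apply pow_lt_one₀ (by positivity) _ (Nat.succ_ne_zero n)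
    rw [div_lt_one (by positivity)]
    exact hlt
  nlinarith

lemma sq_dotProduct_le_of_posDef {n : ℕ} {N : Matrix (Fin n) (Fin n) ℝ} (hN : N.PosDef)
    (e g : Fin n → ℝ) :
    (e ⬝ᵥ g) ^ 2 ≤ (e ⬝ᵥ N *ᵥ e) * (g ⬝ᵥ N⁻¹ *ᵥ g) := by
  have hu : IsUnit N.det := hN.det_pos.ne'.isUnit
  set y := N⁻¹ *ᵥ g with hy
  have hNy : N *ᵥ y = g := by
    rw [hy, Matrix.mulVec_mulVec, Matrix.mul_nonsing_inv _ hu, Matrix.one_mulVec]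
  have hsym : Nᵀ = N := by simpa using hN.isHermitian.eq
  have hyNe : y ⬝ᵥ N *ᵥ e = e ⬝ᵥ g := by
    rw [Matrix.dotProduct_mulVec, ← Matrix.mulVec_transpose, hsym, hNy, dotProduct_comm]
  have hq : ∀ s : ℝ, 0 ≤ (e ⬝ᵥ N *ᵥ e) * (s * s) + (-2 * (e ⬝ᵥ g)) * s + g ⬝ᵥ y := by
    intro s
    have := hN.posSemidef.dotProduct_mulVec_nonneg (s • e - y)
    simp only [star_trivial, Matrix.mulVec_sub, Matrix.mulVec_smul, sub_dotProduct,
      dotProduct_sub, smul_dotProduct, dotProduct_smul, hNy, hyNe, smul_eq_mul] at this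
    rw [dotProduct_comm y g] at this
    linarith
  have := discrim_le_zero hq
  rw [discrim] at this
  nlinarith

lemma trace_inv_mul_vecMulVec {n : ℕ} (N : Matrix (Fin n) (Fin n) ℝ) (g : Fin n → ℝ) :
    (N⁻¹ * vecMulVec g g).trace = g ⬝ᵥ N⁻¹ *ᵥ g := by
  rw [Matrix.mul_vecMulVec, Matrix.trace_vecMulVec, dotProduct_comm]

/-- `Φ` has spatial gradient `P`, spatial Hessian `M` and time derivative `D` on the lower
half-space, all of them jointly continuous there. -/
structure HasC21 {n : ℕ} (Φ : En n → ℝ → ℝ) (P : En n → ℝ → En n)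
    (M : En n → ℝ → Matrix (Fin n) (Fin n) ℝ) (D : En n → ℝ → ℝ) : Prop where
  grad : ∀ x t, t ≤ 0 → HasFDerivAt (fun y => Φ y t) (innerSL ℝ (P x t)) x
  hess : ∀ x t, t ≤ 0 → HasFDerivAt (fun y => P y t) (toEuclideanCLM (𝕜 := ℝ) (M x t)) x
  time : ∀ x t, t ≤ 0 → HasDerivAt (Φ x) (D x t) t
  symm : ∀ x t, t ≤ 0 → (M x t).IsSymm
  cont_fun : ContinuousOn (fun z : En n × ℝ => Φ z.1 z.2) (halfSpace n)
  cont_grad : ContinuousOn (fun z : En n × ℝ => P z.1 z.2) (halfSpace n)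
  cont_hess : ContinuousOn (fun z : En n × ℝ => M z.1 z.2) (halfSpace n)
  cont_time : ContinuousOn (fun z : En n × ℝ => D z.1 z.2) (halfSpace n)

lemma mem_halfSpace {n : ℕ} {z : En n × ℝ} : z ∈ halfSpace n ↔ z.2 ≤ 0 := by
  simp [halfSpace]

lemma isClosed_halfSpace (n : ℕ) : IsClosed (halfSpace n) := isClosed_univ.prod isClosed_Iic

namespace HasC21

variable {n : ℕ} {Φ Ψ : En n → ℝ → ℝ} {P R : En n → ℝ → En n}
  {M S : En n → ℝ → Matrix (Fin n) (Fin n) ℝ} {D F : En n → ℝ → ℝ}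

lemma add (h : HasC21 Φ P M D) (h' : HasC21 Ψ R S F) :
    HasC21 (fun x t => Φ x t + Ψ x t) (fun x t => P x t + R x t) (fun x t => M x t + S x t)
      (fun x t => D x t + F x t) where
  grad x t ht := by rw [map_add]; exact (h.grad x t ht).add (h'.grad x t ht)
  hess x t ht := by rw [map_add]; exact (h.hess x t ht).add (h'.hess x t ht)
  time x t ht := (h.time x t ht).add (h'.time x t ht)
  symm x t ht := (h.symm x t ht).add (h'.symm x t ht)
  cont_fun := h.cont_fun.add h'.cont_fun
  cont_grad := h.cont_grad.add h'.cont_grad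
  cont_hess := h.cont_hess.add h'.cont_hess
  cont_time := h.cont_time.add h'.cont_time

lemma const_mul (h : HasC21 Φ P M D) (c : ℝ) :
    HasC21 (fun x t => c * Φ x t) (fun x t => c • P x t) (fun x t => c • M x t)
      (fun x t => c * D x t) where
  grad x t ht := by
    rw [map_smul]; exact (h.grad x t ht).const_mul c
  hess x t ht := by rw [map_smul]; exact (h.hess x t ht).const_smul c
  time x t ht := (h.time x t ht).const_mul c
  symm x t ht := (h.symm x t ht).smul c
  cont_fun := h.cont_fun.const_mul c
  cont_grad := h.cont_grad.const_smul c
  cont_hess := h.cont_hess.const_smul c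
  cont_time := h.cont_time.const_mul c

lemma mapsTo_translate (e : En n) :
    MapsTo (fun z : En n × ℝ => (z.1 + e, z.2)) (halfSpace n) (halfSpace n) := by
  intro z hz
  exact mem_halfSpace.2 (mem_halfSpace.1 hz)

lemma translate (h : HasC21 Φ P M D) (e : En n) :
    HasC21 (fun x t => Φ (x + e) t) (fun x t => P (x + e) t) (fun x t => M (x + e) t)
      (fun x t => D (x + e) t) where
  grad x t ht := by
    simpa [Function.comp_def] using (h.grad (x + e) t ht).comp x ((hasFDerivAt_id x).add_const e)
  hess x t ht := by
    simpa [Function.comp_def] using (h.hess (x + e) t ht).comp x ((hasFDerivAt_id x).add_const e)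
  time x t ht := h.time (x + e) t ht
  symm x t ht := h.symm (x + e) t ht
  cont_fun := h.cont_fun.comp (f := fun z : En n × ℝ => (z.1 + e, z.2)) (by fun_prop)
    (mapsTo_translate e)
  cont_grad := h.cont_grad.comp (f := fun z : En n × ℝ => (z.1 + e, z.2)) (by fun_prop)
    (mapsTo_translate e)
  cont_hess := h.cont_hess.comp (f := fun z : En n × ℝ => (z.1 + e, z.2)) (by fun_prop)
    (mapsTo_translate e)
  cont_time := h.cont_time.comp (f := fun z : En n × ℝ => (z.1 + e, z.2)) (by fun_prop)
    (mapsTo_translate e)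

lemma affine (a : En n) (b : ℝ) :
    HasC21 (fun x _ => ⟪a, x⟫ + b) (fun _ _ => a) (fun _ _ => 0) (fun _ _ => 0) where
  grad x t _ := (innerSL ℝ a).hasFDerivAt.add_const b
  hess x t _ := by rw [map_zero]; exact hasFDerivAt_const _ _
  time x t _ := hasDerivAt_const _ _
  symm x t _ := Matrix.isSymm_zero
  cont_fun := by fun_prop
  cont_grad := by fun_prop
  cont_hess := by fun_prop
  cont_time := by fun_prop

lemma sq (h : HasC21 Φ P M D) :
    HasC21 (fun x t => Φ x t ^ 2) (fun x t => (2 * Φ x t) • P x t)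
      (fun x t => (2 * Φ x t) • M x t + (2 : ℝ) • vecMulVec (P x t) (P x t))
      (fun x t => 2 * Φ x t * D x t) where
  grad x t ht := by
    rw [map_smul]
    have := (h.grad x t ht).pow 2
    simpa using this
  hess x t ht := by
    have := ((h.grad x t ht).const_mul 2).smul (h.hess x t ht)
    refine this.congr_fderiv ?_
    ext v i
    simp [Matrix.vecMulVec_mulVec, PiLp.inner_apply, dotProduct, mul_comm]
    ring
  time x t ht := by
    have := (h.time x t ht).fun_pow 2
    simpa using this
  symm x t ht := ((h.symm x t ht).smul _).add
    (IsSymm.smul (by rw [IsSymm, transpose_vecMulVec]) _)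
  cont_fun := h.cont_fun.pow 2
  cont_grad := (h.cont_fun.const_mul 2).smul h.cont_grad
  cont_hess := by
    have hv : Continuous fun v : En n => (2 : ℝ) • vecMulVec v.ofLp v.ofLp := by
      have : Continuous fun v : En n => vecMulVec v.ofLp v.ofLp := by
        apply Continuous.matrix_vecMulVec <;> fun_prop
      exact this.const_smul (2 : ℝ)
    exact ((h.cont_fun.const_mul 2).smul h.cont_hess).add (hv.comp_continuousOn h.cont_grad)
  cont_time := (h.cont_fun.const_mul 2).mul h.cont_time

/-- First and second order conditions at a spatial maximum of `Φ(·,t) - ⟪p, ·⟫`. -/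
lemma of_isMax (h : HasC21 Φ P M D) {x p : En n} {t : ℝ} (ht : t ≤ 0)
    (hmax : ∀ y, Φ y t - ⟪p, y⟫ ≤ Φ x t - ⟪p, x⟫) :
    P x t = p ∧ (-M x t).PosSemidef := by
  have hline : ∀ (w : En n) (r : ℝ), HasDerivAt (fun r : ℝ => Φ (x + r • w) t - ⟪p, x + r • w⟫)
      ⟪P (x + r • w) t - p, w⟫ r := by
    intro w r
    have h1 : HasDerivAt (fun r : ℝ => x + r • w) w r := by
      simpa using ((hasDerivAt_id r).smul_const w).const_add x
    have h2 := ((h.grad (x + r • w) t ht).sub (innerSL ℝ p).hasFDerivAt).comp_hasDerivAt r h1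
    simpa [inner_sub_left, Function.comp_def] using h2
  have hloc : ∀ w : En n, IsLocalMax (fun r : ℝ => Φ (x + r • w) t - ⟪p, x + r • w⟫) 0 := by
    intro w
    refine Filter.Eventually.of_forall fun r => ?_
    simpa using hmax (x + r • w)
  have hzero : ∀ w : En n, ⟪P x t - p, w⟫ = 0 := by
    intro w
    have := (hloc w).hasDerivAt_eq_zero (hline w 0)
    simpa using this
  have hP : P x t = p := by
    have := hzero (P x t - p)
    rw [inner_self_eq_zero] at this
    exact sub_eq_zero.1 this
  refine ⟨hP, PosSemidef.of_dotProduct_mulVec_nonneg ?_ ?_⟩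
  · have := h.symm x t ht
    simp [IsHermitian, this.eq]
  · intro w'
    set w : En n := WithLp.toLp 2 w' with hw
    have hd1 : deriv (fun r : ℝ => Φ (x + r • w) t - ⟪p, x + r • w⟫)
        = fun r : ℝ => ⟪P (x + r • w) t - p, w⟫ := funext fun r => (hline w r).deriv
    have hd2 : HasDerivAt (fun r : ℝ => ⟪P (x + r • w) t - p, w⟫)
        (w' ⬝ᵥ M x t *ᵥ w') 0 := by
      have h1 : HasDerivAt (fun r : ℝ => x + r • w) w 0 := by
        simpa using ((hasDerivAt_id (0 : ℝ)).smul_const w).const_add x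
      have h0 : HasFDerivAt (fun y => P y t) (toEuclideanCLM (𝕜 := ℝ) (M x t))
          (x + (0 : ℝ) • w) := by simpa using h.hess x t ht
      have h2 := ((h0.comp_hasDerivAt (0 : ℝ) h1).sub_const p).inner ℝ (hasDerivAt_const 0 w)
      have h3 : ⟪toEuclideanCLM (𝕜 := ℝ) (M x t) w, w⟫ = w' ⬝ᵥ M x t *ᵥ w' := by
        rw [real_inner_comm, inner_toEuclideanCLM]
      simpa [Function.comp_def, h3] using h2
    simp only [star_trivial, Matrix.neg_mulVec, dotProduct_neg, Left.nonneg_neg_iff]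
    by_contra! hpos
    have hmin : IsLocalMin (fun r : ℝ => Φ (x + r • w) t - ⟪p, x + r • w⟫) 0 := by
      apply isLocalMin_of_deriv_deriv_pos
      · rw [hd1, hd2.deriv]; exact hpos
      · rw [hd1]; simp [hP]
      · exact (hline w 0).continuousAt
    have hconst : (fun r : ℝ => Φ (x + r • w) t - ⟪p, x + r • w⟫)
        =ᶠ[𝓝 0] fun _ => Φ (x + (0 : ℝ) • w) t - ⟪p, x + (0 : ℝ) • w⟫ := by
      filter_upwards [hmin, hloc w] with r h1 h2
      exact le_antisymm h2 h1
    have hdd := hconst.deriv.deriv_eq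
    rw [hd1, hd2.deriv] at hdd
    simp at hdd
    exact hpos.ne' hdd

lemma time_nonneg_of_isMax (h : HasC21 Φ P M D) {x : En n} {t : ℝ} (ht : t ≤ 0)
    (hmax : ∀ s ≤ t, Φ x s ≤ Φ x t) : 0 ≤ D x t := by
  have h1 := (h.time x t ht).hasDerivWithinAt (s := Iic t)
  rw [hasDerivWithinAt_iff_tendsto_slope] at h1
  have : (Iic t \ {t}) = Iio t := by ext; simp [lt_iff_le_and_ne]
  rw [this] at h1
  refine ge_of_tendsto h1 ?_
  filter_upwards [self_mem_nhdsWithin] with s hs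
  rw [slope_def_field]
  have hs' : s < t := hs
  have := hmax s hs'.le
  exact div_nonneg_of_nonpos (by linarith) (by linarith)

/-- The gradient inequality for convex functions. -/
lemma add_inner_le_of_convexOn (h : HasC21 Φ P M D) {t : ℝ} (ht : t ≤ 0)
    (hc : ConvexOn ℝ univ (fun x => Φ x t)) (x y : En n) :
    Φ x t + ⟪P x t, y - x⟫ ≤ Φ y t := by
  have h1 : HasDerivAt (fun r : ℝ => x + r • (y - x)) (y - x) 0 := by
    simpa using ((hasDerivAt_id (0 : ℝ)).smul_const (y - x)).const_add x
  have h0 : HasFDerivAt (fun y => Φ y t) (innerSL ℝ (P x t)) (x + (0 : ℝ) • (y - x)) := by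
    simpa using h.grad x t ht
  have h2 := h0.comp_hasDerivAt (0 : ℝ) h1
  have hconv : ConvexOn ℝ univ ((fun y => Φ y t) ∘ fun r : ℝ => x + r • (y - x)) := by
    have hl : (fun r : ℝ => x + r • (y - x)) = AffineMap.lineMap x y := by
      ext r : 1
      simp [AffineMap.lineMap_apply, add_comm]
    rw [hl]
    exact hc.comp_affineMap (AffineMap.lineMap x y)
  have := hconv.le_slope_of_hasDerivAt (mem_univ 0) (mem_univ 1) zero_lt_one h2
  simp [slope_def_field] at this
  linarith

lemma posSemidef_of_convexOn (h : HasC21 Φ P M D) {t : ℝ} (ht : t ≤ 0)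
    (hc : ConvexOn ℝ univ (fun x => Φ x t)) (x : En n) : (M x t).PosSemidef := by
  have := ((h.const_mul (-1)).of_isMax (x := x) (p := -P x t) ht (fun y => by
    have := h.add_inner_le_of_convexOn ht hc x y
    simp only [inner_neg_left, inner_sub_right] at *
    linarith)).2
  simpa using this

end HasC21

lemma det_toEuclideanCLM {n : ℕ} (M : Matrix (Fin n) (Fin n) ℝ) :
    (toEuclideanCLM (𝕜 := ℝ) M).det = M.det := by
  rw [ContinuousLinearMap.det, coe_toEuclideanCLM_eq_toEuclideanLin,
    toEuclideanLin_eq_toLin_orthonormal,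
    LinearMap.det_toLin]

/-- A set function bounded by an integral on all small compact sets is bounded by it on every
compact set. -/
lemma measure_image_le_lintegral_of_local {X Y : Type*} [MetricSpace X]
    [TopologicalSpace.SeparableSpace X]
    [MeasurableSpace X] [BorelSpace X] [Nonempty X] [MeasurableSpace Y] (μ : Measure X)
    (ν : Measure Y) (T : X → Y) (g : X → ℝ≥0∞) {r : ℝ} (hr : 0 < r) {E : Set X}
    (hE : IsCompact E)
    (h : ∀ K ⊆ E, IsCompact K → ∀ c, K ⊆ Metric.closedBall c r →
      ν (T '' K) ≤ ∫⁻ x in K, g x ∂μ) :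
    ν (T '' E) ≤ ∫⁻ x in E, g x ∂μ := by
  set B : ℕ → Set X := fun k => Metric.closedBall (TopologicalSpace.denseSeq X k) r with hB
  have hBc : ∀ k, IsClosed (B k) := fun k => Metric.isClosed_closedBall
  have hcov : (⋃ k, B k) = univ := by
    refine eq_univ_of_forall fun x => ?_
    obtain ⟨k, hk⟩ := (TopologicalSpace.denseRange_denseSeq X).exists_dist_lt x hr
    exact mem_iUnion.2 ⟨k, Metric.mem_closedBall.2 hk.le⟩
  have hd : ∀ k, ∃ U : Set X, IsOpen U ∧ disjointed B k = B k ∩ U := by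
    intro k
    refine ⟨(⋃ j ∈ Finset.range k, B j)ᶜ, ?_, ?_⟩
    · exact (isClosed_biUnion_finset fun j _ => hBc j).isOpen_compl
    · ext x
      simp [disjointed_apply, Finset.sup_eq_iSup]
  have hpiece : ∀ k, ν (T '' (E ∩ disjointed B k)) ≤ ∫⁻ x in E ∩ disjointed B k, g x ∂μ := by
    intro k
    obtain ⟨U, hU, hUk⟩ := hd k
    obtain ⟨F, hFc, hFU, hFun, hFm⟩ := hU.exists_iUnion_isClosed
    have e1 : E ∩ disjointed B k = ⋃ j, E ∩ (B k ∩ F j) := by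
      rw [hUk, ← hFun, ← inter_iUnion, ← inter_iUnion]
    have hmono : Monotone fun j => T '' (E ∩ (B k ∩ F j)) := fun i j hij =>
      image_mono (inter_subset_inter_right _ (inter_subset_inter_right _ (hFm hij)))
    have e2 : T '' (E ∩ disjointed B k) = ⋃ j, T '' (E ∩ (B k ∩ F j)) := by
      rw [e1, image_iUnion]
    rw [e2, hmono.measure_iUnion]
    refine iSup_le fun j => ?_
    refine (h _ inter_subset_left (hE.inter_right ((hBc k).inter (hFc j)))
      (TopologicalSpace.denseSeq X k) fun x hx => hx.2.1).trans ?_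
    apply lintegral_mono_set
    rw [e1]
    exact subset_iUnion (fun j => E ∩ (B k ∩ F j)) j
  have hEu : E = ⋃ k, E ∩ disjointed B k := by
    rw [← inter_iUnion, iUnion_disjointed, hcov, inter_univ]
  calc ν (T '' E) ≤ ∑' k, ν (T '' (E ∩ disjointed B k)) := by
        conv_lhs => rw [hEu, image_iUnion]
        exact measure_iUnion_le _
    _ ≤ ∑' k, ∫⁻ x in E ∩ disjointed B k, g x ∂μ := ENNReal.tsum_le_tsum hpiece
    _ = ∫⁻ x in E, g x ∂μ := by
        conv_rhs => rw [hEu]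
        rw [lintegral_iUnion]
        · exact fun k => hE.measurableSet.inter
            (MeasurableSet.disjointed (fun j => (hBc j).measurableSet) k)
        · intro i j hij
          exact (disjoint_disjointed B hij).mono inter_subset_right inter_subset_right

namespace HasC21

variable {n : ℕ} {Φ : En n → ℝ → ℝ} {P : En n → ℝ → En n}
  {M : En n → ℝ → Matrix (Fin n) (Fin n) ℝ} {D : En n → ℝ → ℝ}

/-- The pair consisting of the gradient and the Legendre-type transform. -/
def contactMap (Φ : En n → ℝ → ℝ) (P : En n → ℝ → En n) (z : En n × ℝ) : En n × ℝ :=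
  (P z.1 z.2, Φ z.1 z.2 - ⟪P z.1 z.2, z.1⟫)

lemma continuousOn_contactMap (h : HasC21 Φ P M D) :
    ContinuousOn (contactMap Φ P) (halfSpace n) :=
  h.cont_grad.prodMk (h.cont_fun.sub (h.cont_grad.inner continuous_fst.continuousOn))

lemma continuousOn_det (h : HasC21 Φ P M D) :
    ContinuousOn (fun z : En n × ℝ => (M z.1 z.2).det) (halfSpace n) :=
  (Continuous.matrix_det continuous_id).comp_continuousOn h.cont_hess

lemma volume_gradient_image_le (h : HasC21 Φ P M D) {K : Set (En n × ℝ)} (hK : IsCompact K)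
    (hKH : K ⊆ halfSpace n) :
    volume ((fun z : En n × ℝ => (P z.1 z.2, z.2)) '' K) ≤
      ∫⁻ z in K, ENNReal.ofReal |(M z.1 z.2).det| := by
  have hSc : IsCompact ((fun z : En n × ℝ => (P z.1 z.2, z.2)) '' K) :=
    hK.image_of_continuousOn ((h.cont_grad.mono hKH).prodMk continuous_snd.continuousOn)
  have hmeas : AEMeasurable (K.indicator fun z : En n × ℝ => ENNReal.ofReal |(M z.1 z.2).det|)
      ((volume : Measure (En n)).prod (volume : Measure ℝ)) := by
    rw [aemeasurable_indicator_iff hK.measurableSet]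
    exact ((h.continuousOn_det.mono hKH).aemeasurable hK.measurableSet).abs.ennreal_ofReal
  rw [← lintegral_indicator hK.measurableSet, Measure.volume_eq_prod,
    Measure.prod_apply_symm hSc.measurableSet, lintegral_prod_symm _ hmeas]
  refine lintegral_mono fun t => ?_
  have hKt : MeasurableSet {x : En n | (x, t) ∈ K} :=
    (hK.isClosed.preimage (by fun_prop : Continuous fun x : En n => (x, t))).measurableSet
  have e1 : (fun x : En n => (x, t)) ⁻¹' ((fun z : En n × ℝ => (P z.1 z.2, z.2)) '' K)
      = (fun y => P y t) '' {x : En n | (x, t) ∈ K} := by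
    ext p
    constructor
    · rintro ⟨⟨x, s⟩, hz, hzp⟩
      simp only [Prod.mk.injEq] at hzp
      obtain ⟨h1, rfl⟩ := hzp
      exact ⟨x, hz, h1⟩
    · rintro ⟨x, hx, rfl⟩
      exact ⟨(x, t), hx, rfl⟩
  rw [e1]
  have e2 : ∀ x : En n, K.indicator (fun z : En n × ℝ => ENNReal.ofReal |(M z.1 z.2).det|) (x, t)
      = {x : En n | (x, t) ∈ K}.indicator (fun x => ENNReal.ofReal |(M x t).det|) x := fun x => rfl
  simp_rw [e2]
  rw [lintegral_indicator hKt]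
  refine (addHaar_image_le_lintegral_abs_det_fderiv volume hKt (fun x hx =>
    (h.hess x t (mem_halfSpace.1 (hKH hx))).hasFDerivWithinAt)).trans ?_
  simp_rw [det_toEuclideanCLM]
  exact le_rfl

lemma volume_contactMap_image_le_mul (h : HasC21 Φ P M D) {K : Set (En n × ℝ)}
    (hK : IsCompact K) (hKH : K ⊆ halfSpace n)
    (hcontact : ∀ z ∈ K, ∀ y, Φ y z.2 - ⟪P z.1 z.2, y⟫ ≤ Φ z.1 z.2 - ⟪P z.1 z.2, z.1⟫)
    {I : Set ℝ} (hI : Convex ℝ I) (hI0 : I ⊆ Iic 0) (hKI : ∀ z ∈ K, z.2 ∈ I) {a : ℝ≥0}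
    (ha : ∀ z ∈ K, ∀ s ∈ I, |D z.1 s| ≤ a) :
    volume (contactMap Φ P '' K) ≤ a * ∫⁻ z in K, ENNReal.ofReal |(M z.1 z.2).det| := by
  have hSc : IsCompact ((fun z : En n × ℝ => (P z.1 z.2, z.2)) '' K) :=
    hK.image_of_continuousOn ((h.cont_grad.mono hKH).prodMk continuous_snd.continuousOn)
  have hTc : IsCompact (contactMap Φ P '' K) :=
    hK.image_of_continuousOn (h.continuousOn_contactMap.mono hKH)
  refine le_trans ?_ (mul_le_mul_right (h.volume_gradient_image_le hK hKH) (a : ℝ≥0∞))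
  rw [Measure.volume_eq_prod, Measure.prod_apply hSc.measurableSet,
    Measure.prod_apply hTc.measurableSet, ← lintegral_const_mul' _ _ ENNReal.coe_ne_top]
  refine lintegral_mono fun p => ?_
  set W : Set ℝ := Prod.mk p ⁻¹' ((fun z : En n × ℝ => (P z.1 z.2, z.2)) '' K) with hW
  have hWx : ∀ t ∈ W, ∃ x, (x, t) ∈ K ∧ P x t = p := by
    rintro t ⟨⟨x, s⟩, hz, hzp⟩
    simp only [Prod.mk.injEq] at hzp
    obtain ⟨h1, rfl⟩ := hzp
    exact ⟨x, hz, h1⟩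
  choose! ξ hξK hξp using hWx
  set θ : ℝ → ℝ := fun t => Φ (ξ t) t - ⟪p, ξ t⟫ with hθ
  have hsub : Prod.mk p ⁻¹' (contactMap Φ P '' K) ⊆ θ '' W := by
    rintro η ⟨⟨x, t⟩, hz, hzp⟩
    simp only [contactMap, Prod.mk.injEq] at hzp
    obtain ⟨h1, rfl⟩ := hzp
    have htW : t ∈ W := ⟨(x, t), hz, by simp [h1]⟩
    refine ⟨t, htW, ?_⟩
    have c1 := hcontact _ hz (ξ t)
    have c2 := hcontact _ (hξK t htW) x
    simp only [h1, hξp t htW] at c1 c2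
    simp only [hθ, h1]
    linarith
  have hone : ∀ s ∈ W, ∀ t ∈ W, θ t - θ s ≤ a * |t - s| := by
    intro s hs t ht
    have c1 := hcontact _ (hξK s hs) (ξ t)
    simp only [hξp s hs] at c1
    have hmv := hI.norm_image_sub_le_of_norm_hasDerivWithin_le (f := Φ (ξ t)) (f' := D (ξ t))
      (C := a) (x := s) (y := t)
      (fun r hr => (h.time (ξ t) r (hI0 hr)).hasDerivWithinAt)
      (fun r hr => ha _ (hξK t ht) r hr) (hKI _ (hξK s hs)) (hKI _ (hξK t ht))
    rw [Real.norm_eq_abs, Real.norm_eq_abs] at hmv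
    have := le_abs_self (Φ (ξ t) t - Φ (ξ t) s)
    simp only [hθ]
    linarith
  have hlip : LipschitzOnWith a θ W := by
    refine LipschitzOnWith.of_dist_le_mul fun t ht s hs => ?_
    rw [Real.dist_eq, Real.dist_eq, abs_le]
    have h1 := hone s hs t ht
    have h2 := hone t ht s hs
    rw [abs_sub_comm] at h2
    constructor <;> linarith
  have := hlip.hausdorffMeasure_image_le (d := 1) zero_le_one
  rw [hausdorffMeasure_real] at this
  simp only [ENNReal.rpow_one] at this
  exact (measure_mono hsub).trans this

/-- The area inequality for the contact map. -/
lemma volume_contactMap_image_le (h : HasC21 Φ P M D) {E : Set (En n × ℝ)}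
    (hE : IsCompact E) (hEH : E ⊆ halfSpace n)
    (hcontact : ∀ z ∈ E, ∀ y, Φ y z.2 - ⟪P z.1 z.2, y⟫ ≤ Φ z.1 z.2 - ⟪P z.1 z.2, z.1⟫) :
    volume (contactMap Φ P '' E) ≤
      ∫⁻ z in E, ENNReal.ofReal |D z.1 z.2| * ENNReal.ofReal |(M z.1 z.2).det| := by
  have hEm := hE.measurableSet
  have hdetm : AEMeasurable (fun z : En n × ℝ => ENNReal.ofReal |(M z.1 z.2).det|)
      (volume.restrict E) :=
    ((h.continuousOn_det.mono hEH).aemeasurable hEm).abs.ennreal_ofReal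
  have hDm : AEMeasurable (fun z : En n × ℝ => ENNReal.ofReal |D z.1 z.2|)
      (volume.restrict E) := ((h.cont_time.mono hEH).aemeasurable hEm).abs.ennreal_ofReal
  have hfin : ∫⁻ z in E, ENNReal.ofReal |(M z.1 z.2).det| ≠ ⊤ := by
    have := ((h.continuousOn_det.mono hEH).integrableOn_compact hE
      (μ := (volume : Measure (En n × ℝ)))).2.ne
    simpa [HasFiniteIntegral, ← ofReal_norm] using this
  have key : ∀ δ : ℝ≥0, 0 < δ → volume (contactMap Φ P '' E) ≤
      (∫⁻ z in E, ENNReal.ofReal |D z.1 z.2| * ENNReal.ofReal |(M z.1 z.2).det|)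
        + δ * ∫⁻ z in E, ENNReal.ofReal |(M z.1 z.2).det| := by
    intro δ hδ
    obtain ⟨R, hR⟩ := hE.isBounded.subset_closedBall 0
    set Q : Set (En n × ℝ) := Metric.closedBall 0 (R + 2) ∩ halfSpace n with hQ
    have hQc : IsCompact Q := (isCompact_closedBall _ _).inter_right (isClosed_halfSpace n)
    have huc := hQc.uniformContinuousOn_of_continuous (h.cont_time.mono inter_subset_right)
    rw [Metric.uniformContinuousOn_iff] at huc
    obtain ⟨d, hd, hdu⟩ := huc δ (by exact_mod_cast hδ)
    have hr : 0 < min (d / 3) 1 := lt_min (by positivity) one_pos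
    have hr1 : min (d / 3) 1 ≤ d / 3 := min_le_left _ _
    have hr2 : min (d / 3) 1 ≤ 1 := min_le_right _ _
    set r := min (d / 3) 1
    have hprod : AEMeasurable (fun z : En n × ℝ =>
        ENNReal.ofReal |D z.1 z.2| * ENNReal.ofReal |(M z.1 z.2).det|) (volume.restrict E) :=
      hDm.mul hdetm
    rw [← lintegral_const_mul' _ _ ENNReal.coe_ne_top, ← lintegral_add_left' hprod]
    refine measure_image_le_lintegral_of_local volume volume (contactMap Φ P) _ hr hE ?_
    intro K hKE hK c hKc
    rcases K.eq_empty_or_nonempty with rfl | ⟨z₀, hz₀⟩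
    · simp
    set I : Set ℝ := Metric.closedBall c.2 r ∩ Iic 0 with hI
    have hmemQ : ∀ z ∈ K, ∀ s ∈ I, (z.1, s) ∈ Q ∧ ∀ w ∈ K, dist (z.1, s) w < d := by
      intro z hz s hs
      have hzc := hKc hz
      have hsw : ∀ w ∈ K, dist (z.1, s) w ≤ 2 * r := by
        intro w hw
        have hwc := hKc hw
        rw [Metric.mem_closedBall, Prod.dist_eq, max_le_iff] at hwc hzc
        rw [Prod.dist_eq, max_le_iff]
        have h3 := Metric.mem_closedBall.1 hs.1
        constructor
        · have := dist_triangle_right z.1 w.1 c.1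
          simp only; linarith
        · have := dist_triangle_right s w.2 c.2
          simp only; linarith
      refine ⟨⟨?_, mem_halfSpace.2 hs.2⟩, fun w hw => (hsw w hw).trans_lt (by linarith)⟩
      have h4 := Metric.mem_closedBall.1 (hR (hKE hz))
      have h5 := dist_triangle (z.1, s) z 0
      have := hsw z hz
      exact Metric.mem_closedBall.2 (by linarith)
    have hKI : ∀ z ∈ K, z.2 ∈ I := by
      intro z hz
      have hzc := hKc hz
      rw [Metric.mem_closedBall, Prod.dist_eq, max_le_iff] at hzc
      exact ⟨Metric.mem_closedBall.2 hzc.2, mem_halfSpace.1 (hEH (hKE hz))⟩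
    have hosc : ∀ z ∈ K, ∀ s ∈ I, ∀ w ∈ K, |D z.1 s| ≤ |D w.1 w.2| + δ := by
      intro z hz s hs w hw
      have hw' := (hmemQ w hw w.2 (hKI w hw)).1
      have := hdu _ (hmemQ z hz s hs).1 _ hw' ((hmemQ z hz s hs).2 w hw)
      rw [Real.dist_eq] at this
      have h2 := abs_sub_abs_le_abs_sub (D z.1 s) (D w.1 w.2)
      simp only at this
      linarith
    obtain ⟨w₀, hw₀, hmin⟩ := hK.exists_isMinOn ⟨z₀, hz₀⟩
      ((h.cont_time.mono (hKE.trans hEH)).abs)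
    refine (h.volume_contactMap_image_le_mul hK (hKE.trans hEH)
      (fun z hz => hcontact z (hKE hz)) (I := I)
      ((convex_closedBall _ _).inter (convex_Iic 0)) inter_subset_right hKI
      (a := Real.toNNReal (|D w₀.1 w₀.2| + δ)) (fun z hz s hs => by
        rw [Real.coe_toNNReal _ (by positivity)]
        exact hosc z hz s hs w₀ hw₀)).trans ?_
    rw [← lintegral_const_mul' _ _ ENNReal.coe_ne_top]
    refine setLIntegral_mono_ae' hK.measurableSet (Eventually.of_forall fun z hz => ?_)
    rw [← add_mul]
    gcongr
    have : |D w₀.1 w₀.2| ≤ |D z.1 z.2| := hmin hz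
    rw [← ENNReal.ofReal_coe_nnreal (p := δ),
      ← ENNReal.ofReal_add (abs_nonneg _) (NNReal.coe_nonneg δ)]
    exact ENNReal.ofReal_le_ofReal (by linarith)
  refine ENNReal.le_of_forall_pos_le_add fun ε hε _ => ?_
  set J := ∫⁻ z in E, ENNReal.ofReal |(M z.1 z.2).det| with hJ
  have hδ : 0 < ε / (J.toNNReal + 1) := by positivity
  refine (key _ hδ).trans ?_
  gcongr
  rw [← ENNReal.coe_toNNReal hfin, ← ENNReal.coe_mul, ENNReal.coe_le_coe, div_mul_eq_mul_div,
    div_le_iff₀ (by positivity)]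
  gcongr
  exact le_self_add

end HasC21

lemma isCompact_parabolic (n : ℕ) (R : ℝ) :
    IsCompact {z : En n × ℝ | z.2 ≤ 0 ∧ ‖z.1‖ ^ 2 - z.2 ≤ R} := by
  have hsub : {z : En n × ℝ | z.2 ≤ 0 ∧ ‖z.1‖ ^ 2 - z.2 ≤ R} ⊆
      Metric.closedBall (0 : En n) (1 + |R|) ×ˢ Icc (-|R|) 0 := by
    rintro ⟨x, t⟩ ⟨h1, h2⟩
    simp only at h1 h2
    have h3 := le_abs_self R
    refine ⟨?_, ?_, h1⟩
    · rw [mem_closedBall_zero_iff]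
      nlinarith [norm_nonneg x, abs_nonneg R]
    · nlinarith [sq_nonneg ‖x‖]
  refine ((isCompact_closedBall _ _).prod isCompact_Icc).of_isClosed_subset ?_ hsub
  exact (isClosed_le continuous_snd continuous_const).inter
    (isClosed_le ((continuous_fst.norm.pow 2).sub continuous_snd) continuous_const)

lemma exists_contact {n : ℕ} {Φ : En n → ℝ → ℝ}
    (hΦ : ContinuousOn (fun z : En n × ℝ => Φ z.1 z.2) (halfSpace n)) {C κ : ℝ} (hκ : 0 < κ)
    (hcoer : ∀ x t, t ≤ 0 → Φ x t ≤ C - κ * (‖x‖ ^ 2 - t)) (p : En n) (η : ℝ)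
    {x₀ : En n} {t₀ : ℝ} (ht₀ : t₀ ≤ 0) (h₀ : η ≤ Φ x₀ t₀ - ⟪p, x₀⟫) :
    ∃ x t, t ≤ 0 ∧ Φ x t - ⟪p, x⟫ = η ∧ ∀ y s, s ≤ t → Φ y s - ⟪p, y⟫ ≤ η := by
  have hψ : ContinuousOn (fun z : En n × ℝ => Φ z.1 z.2 - ⟪p, z.1⟫) (halfSpace n) :=
    hΦ.sub (by fun_prop)
  set K : Set (En n × ℝ) := {z ∈ halfSpace n | η ≤ Φ z.1 z.2 - ⟪p, z.1⟫} with hK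
  have hKclosed : IsClosed K := (isClosed_halfSpace n).isClosed_le continuousOn_const hψ
  have hKc : IsCompact K := by
    refine (isCompact_parabolic n (2 / κ * (C - η + ‖p‖ ^ 2 / (2 * κ)))).of_isClosed_subset
      hKclosed ?_
    rintro ⟨x, t⟩ ⟨h1, h2⟩
    rw [mem_halfSpace] at h1
    simp only at h1 h2
    refine ⟨h1, ?_⟩
    have h3 := hcoer x t h1
    have h4 : -(‖p‖ * ‖x‖) ≤ ⟪p, x⟫ := (abs_le.1 (abs_real_inner_le_norm p x)).1
    have h5 : ‖p‖ * ‖x‖ ≤ ‖p‖ ^ 2 / (2 * κ) + κ / 2 * ‖x‖ ^ 2 := by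
      have : 0 ≤ (‖p‖ - κ * ‖x‖) ^ 2 / (2 * κ) := by positivity
      have e : (‖p‖ - κ * ‖x‖) ^ 2 / (2 * κ) =
          ‖p‖ ^ 2 / (2 * κ) + κ / 2 * ‖x‖ ^ 2 - ‖p‖ * ‖x‖ := by
        field_simp; ring
      linarith
    simp only
    have h6 : κ / 2 * (‖x‖ ^ 2 - t) ≤ C - η + ‖p‖ ^ 2 / (2 * κ) := by
      nlinarith
    calc ‖x‖ ^ 2 - t = 2 / κ * (κ / 2 * (‖x‖ ^ 2 - t)) := by field_simp
      _ ≤ _ := by gcongr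
  obtain ⟨⟨x, t⟩, ⟨hz1, hz2⟩, hmin⟩ := hKc.exists_isMinOn ⟨(x₀, t₀), mem_halfSpace.2 ht₀, h₀⟩
    continuous_snd.continuousOn
  rw [mem_halfSpace] at hz1
  simp only at hz1 hz2
  have hlt : ∀ y s, s < t → Φ y s - ⟪p, y⟫ ≤ η := by
    intro y s hs
    by_contra! hcon
    have := hmin (show ((y, s) : En n × ℝ) ∈ K from ⟨mem_halfSpace.2 (hs.le.trans hz1), hcon.le⟩)
    simp only [mem_ofPred_eq] at this
    linarith
  have hle : ∀ y, Φ y t - ⟪p, y⟫ ≤ η := by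
    intro y
    have hc : ContinuousWithinAt (fun s => Φ y s - ⟪p, y⟫) (Iic t) t := by
      have h1 : ContinuousWithinAt (fun z : En n × ℝ => Φ z.1 z.2 - ⟪p, z.1⟫) (halfSpace n)
        (y, t) := hψ (y, t) (mem_halfSpace.2 hz1)
      exact h1.comp (t := halfSpace n) (f := fun s : ℝ => ((y, s) : En n × ℝ))
        (by fun_prop) (fun s hs => mem_halfSpace.2 (le_trans hs hz1))
    refine le_of_tendsto (hc.mono Iio_subset_Iic_self).tendsto ?_
    filter_upwards [self_mem_nhdsWithin] with s hs using hlt y s hs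
  refine ⟨x, t, hz1, le_antisymm (hle x) hz2, fun y s hs => ?_⟩
  rcases hs.lt_or_eq with h | h
  · exact hlt y s h
  · exact h ▸ hle y

/-- Parabolic Aleksandrov–Bakelman–Pucci estimate, in terms of the set of contact parameters. -/
lemma HasC21.exists_contactSet {n : ℕ} {Φ : En n → ℝ → ℝ} {P : En n → ℝ → En n}
    {M : En n → ℝ → Matrix (Fin n) (Fin n) ℝ} {D : En n → ℝ → ℝ}
    (h : HasC21 Φ P M D) {S : Set (En n × ℝ)} (hS : IsCompact S) (hSH : S ⊆ halfSpace n)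
    {Q : Set (En n × ℝ)}
    (hQ : ∀ q ∈ Q, ∃ x t, (x, t) ∈ S ∧ Φ x t - ⟪q.1, x⟫ = q.2 ∧
      ∀ y s, s ≤ t → Φ y s - ⟪q.1, y⟫ ≤ q.2) :
    ∃ E ⊆ S, IsCompact E ∧ (∀ z ∈ E, 0 ≤ D z.1 z.2 ∧ (-M z.1 z.2).PosSemidef) ∧
      volume Q ≤ ∫⁻ z in E, ENNReal.ofReal (D z.1 z.2 * (-M z.1 z.2).det) := by
  set E : Set (En n × ℝ) := {z ∈ S | ∀ (y : En n) (r : ℝ), 0 ≤ r →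
    Φ y (z.2 - r) - ⟪P z.1 z.2, y⟫ ≤ Φ z.1 z.2 - ⟪P z.1 z.2, z.1⟫} with hE
  have hES : E ⊆ S := fun z hz => hz.1
  have hEclosed : IsClosed E := by
    have : E = S ∩ ⋂ (y : En n) (r : ℝ) (_ : 0 ≤ r), {z ∈ S |
        Φ y (z.2 - r) - ⟪P z.1 z.2, y⟫ ≤ Φ z.1 z.2 - ⟪P z.1 z.2, z.1⟫} := by
      ext z; simp only [hE, mem_ofPred_eq, mem_inter_iff, mem_iInter]
      exact ⟨fun h => ⟨h.1, fun y r hr => ⟨h.1, h.2 y r hr⟩⟩,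
        fun h => ⟨h.1, fun y r hr => (h.2 y r hr).2⟩⟩
    rw [this]
    refine hS.isClosed.inter (isClosed_iInter fun y => isClosed_iInter fun r =>
      isClosed_iInter fun hr => hS.isClosed.isClosed_le ?_ ?_)
    · refine ContinuousOn.sub ?_ ((h.cont_grad.mono hSH).inner continuousOn_const)
      refine h.cont_fun.comp (f := fun z : En n × ℝ => ((y, z.2 - r) : En n × ℝ)) (by fun_prop) ?_
      intro z hz
      have := mem_halfSpace.1 (hSH hz)
      exact mem_halfSpace.2 (by simp only; linarith)
    · exact (h.cont_fun.mono hSH).sub ((h.cont_grad.mono hSH).inner continuousOn_fst)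
  have hEc : IsCompact E := hS.of_isClosed_subset hEclosed hES
  have hsign : ∀ z ∈ E, 0 ≤ D z.1 z.2 ∧ (-M z.1 z.2).PosSemidef := by
    intro z hz
    have ht := mem_halfSpace.1 (hSH hz.1)
    refine ⟨h.time_nonneg_of_isMax ht fun s hs => ?_, (h.of_isMax ht (p := P z.1 z.2)
      fun y => by simpa using hz.2 y 0 le_rfl).2⟩
    have := hz.2 z.1 (z.2 - s) (by linarith)
    simpa using this
  refine ⟨E, hES, hEc, hsign, ?_⟩
  have hsub : Q ⊆ contactMap Φ P '' E := by
    rintro q hq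
    obtain ⟨x, t, hxt, heq, hmax⟩ := hQ q hq
    have ht : t ≤ 0 := mem_halfSpace.1 (hSH hxt)
    have hp : P x t = q.1 := (h.of_isMax ht fun y => by rw [heq]; exact hmax y t le_rfl).1
    refine ⟨(x, t), ⟨hxt, fun y r hr => ?_⟩, ?_⟩
    · simp only [hp, heq]; exact hmax y _ (by linarith)
    · simp only [contactMap, hp, heq]
  refine (measure_mono hsub).trans ((h.volume_contactMap_image_le hEc (hES.trans hSH)
    fun z hz y => by simpa using hz.2 y 0 le_rfl).trans ?_)
  refine setLIntegral_mono' hEclosed.measurableSet fun z hz => ?_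
  obtain ⟨h1, h2⟩ := hsign z hz
  rw [← ENNReal.ofReal_mul (abs_nonneg _)]
  refine ENNReal.ofReal_le_ofReal (le_of_eq ?_)
  rw [abs_of_nonneg h1, ← abs_of_nonneg h2.det_nonneg, det_neg, abs_mul]
  simp

lemma IsC2kOn.hasC21 {n : ℕ} {u : En n → ℝ → ℝ} (hu : IsC2kOn 1 u (halfSpace n)) :
    HasC21 u (spaceGrad u) (spaceHess u) (timeDeriv u) := by
  have h2 : ∀ x t, t ≤ 0 → ContDiffAt ℝ 2 (fun y => u y t) x := fun x t ht => by
    simpa using ((hu 2 0 (by norm_num)).1 (x, t) (mem_halfSpace.2 ht)).1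
  have h1 : ∀ x t, t ≤ 0 → DifferentiableAt ℝ (u x) t := fun x t ht => by
    have := ((hu 0 1 (by norm_num)).1 (x, t) (mem_halfSpace.2 ht)).2
    exact this.differentiableAt (by norm_num)
  have hd : ∀ x t, t ≤ 0 → DifferentiableAt ℝ (fun y => u y t) x := fun x t ht =>
    (h2 x t ht).differentiableAt (by norm_num)
  have hcoord : ∀ x t (i : Fin n),
      spaceGrad u x t i = fderiv ℝ (fun y => u y t) x (EuclideanSpace.single i 1) := by
    intro x t i
    have : spaceGrad u x t i = ⟪spaceGrad u x t, EuclideanSpace.single i (1 : ℝ)⟫ := by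
      simp [EuclideanSpace.inner_single_right]
    rw [this, spaceGrad, gradient, InnerProductSpace.toDual_symm_apply]
  have hsymm : ∀ x t, t ≤ 0 → IsSymmSndFDerivAt ℝ (fun y => u y t) x := fun x t ht =>
    (h2 x t ht).isSymmSndFDerivAt (by simp)
  have hM : ∀ x t (i j : Fin n), spaceHess u x t i j =
      fderiv ℝ (fderiv ℝ (fun y => u y t)) x (EuclideanSpace.single i 1)
        (EuclideanSpace.single j 1) := by
    intro x t i j
    simp [spaceHess, iteratedFDeriv_two_apply]
  have c0 := (hu 0 0 (by norm_num)).2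
  have c1 := (hu 1 0 (by norm_num)).2
  have c2 := (hu 2 0 (by norm_num)).2
  have ct := (hu 0 1 (by norm_num)).2
  simp only [iteratedDeriv_zero] at c0 c1 c2
  refine ⟨fun x t ht => ?_, fun x t ht => ?_, fun x t ht => (h1 x t ht).hasDerivAt,
    fun x t ht => ?_, ?_, ?_, ?_, ?_⟩
  · have := (hd x t ht).hasGradientAt.hasFDerivAt
    refine this.congr_fderiv ?_
    ext w
    simp [spaceGrad]
  · rw [← hasFDerivWithinAt_univ, hasFDerivWithinAt_euclidean]
    intro i
    rw [hasFDerivWithinAt_univ]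
    simp_rw [hcoord]
    have hdd : DifferentiableAt ℝ (fderiv ℝ (fun y => u y t)) x :=
      ((h2 x t ht).fderiv_right (m := 1) (by norm_num)).differentiableAt (by norm_num)
    have := hdd.hasFDerivAt.clm_apply (hasFDerivAt_const (EuclideanSpace.single i (1:ℝ)) x)
    refine this.congr_fderiv ?_
    ext w
    have hw : w = ∑ j, w j • EuclideanSpace.single j (1 : ℝ) := by
      ext k
      simp [Finset.sum_apply, Pi.single_apply]
    have e1 : fderiv ℝ (fderiv ℝ (fun y => u y t)) x w (EuclideanSpace.single i 1) =
        ∑ j, spaceHess u x t i j * w j := by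
      rw [(hsymm x t ht).eq]
      conv_lhs => rw [hw]
      simp [map_sum, hM, mul_comm]
    simp [e1, Matrix.mulVec, dotProduct]
  · ext i j
    rw [Matrix.transpose_apply, hM, hM, (hsymm x t ht).eq]
  · exact (ContinuousMultilinearMap.apply ℝ (fun _ : Fin 0 => En n) ℝ 0).continuous.comp_continuousOn
      c0
  · refine (PiLp.continuous_toLp 2 _).comp_continuousOn
      (f := fun z : En n × ℝ => fun i => spaceGrad u z.1 z.2 i) (continuousOn_pi.2 fun i => ?_)
    refine ((ContinuousMultilinearMap.apply ℝ (fun _ : Fin 1 => En n) ℝ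
      (fun _ => EuclideanSpace.single i 1)).continuous.comp_continuousOn c1).congr fun z _ => ?_
    simp [hcoord]
  · refine continuousOn_pi.2 fun i => continuousOn_pi.2 fun j => ?_
    exact (ContinuousMultilinearMap.apply ℝ (fun _ : Fin 2 => En n) ℝ
      ![EuclideanSpace.single i 1, EuclideanSpace.single j 1]).continuous.comp_continuousOn c2
  · refine ((ContinuousMultilinearMap.apply ℝ (fun _ : Fin 0 => En n) ℝ 0).continuous.comp_continuousOn
      ct).congr fun z _ => ?_
    simp [timeDeriv]

lemma periodic_of_forall_int {f : En n → ℝ}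
    (hper : ∀ (x : En n) (i : Fin n), f (x + EuclideanSpace.single i 1) = f x)
    {e : En n} (he : ∀ i, ∃ k : ℤ, e i = (k : ℝ)) : Function.Periodic f e := by
  choose k hk using he
  have hsum : ∀ s : Finset (Fin n),
      Function.Periodic f (∑ i ∈ s, k i • EuclideanSpace.single i (1 : ℝ)) := by
    intro s
    induction s using Finset.induction_on with
    | empty => intro x; simp
    | insert a s ha ih =>
      rw [Finset.sum_insert ha]
      exact (Function.Periodic.zsmul (fun x => hper x a) (k a)).add_period ih
  convert hsum Finset.univ using 1
  ext j
  simp [Finset.sum_apply, Pi.single_apply, hk]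

lemma setLIntegral_biUnion_finset_le {X ι : Type*} [MeasurableSpace X] (μ : Measure X)
    (s : Finset ι) (S : ι → Set X) (g : X → ℝ≥0∞) :
    ∫⁻ x in ⋃ i ∈ s, S i, g x ∂μ ≤ ∑ i ∈ s, ∫⁻ x in S i, g x ∂μ := by
  classical
  induction s using Finset.induction_on with
  | empty => simp
  | insert a s ha ih =>
    rw [Finset.set_biUnion_insert, Finset.sum_insert ha]
    exact (lintegral_union_le _ _ _).trans (by gcongr)

/-- The cube `[-N, N]ⁿ`. -/
def cube (n : ℕ) (N : ℝ) : Set (En n) := {x | ∀ i, |x i| ≤ N}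

/-- The parabolic box `[-N, N]ⁿ × [-N², 0]`. -/
def box (n : ℕ) (N : ℝ) : Set (En n × ℝ) := cube n N ×ˢ Icc (-N ^ 2) 0

lemma isClosed_cube (N : ℝ) : IsClosed (cube n N) := by
  simp only [cube, ofPred_forall]
  exact isClosed_iInter fun i => isClosed_le (by fun_prop) continuous_const

lemma norm_le_of_mem_cube {N : ℝ} {x : En n} (hx : x ∈ cube n N) :
    ‖x‖ ^ 2 ≤ n * N ^ 2 := by
  rw [EuclideanSpace.norm_sq_eq]
  calc ∑ i, ‖x i‖ ^ 2 ≤ ∑ _i : Fin n, N ^ 2 := by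
        gcongr with i
        exact hx i
    _ = _ := by simp

lemma isCompact_cube (N : ℝ) : IsCompact (cube n N) := by
  rcases lt_or_ge N 0 with h | h
  · rcases n with _ | n
    · refine (isCompact_univ (X := En 0)).of_isClosed_subset (isClosed_cube N) (subset_univ _)
    · convert isCompact_empty
      ext x
      simp only [cube, mem_ofPred_eq, mem_empty_iff_false, iff_false, not_forall, not_le]
      exact ⟨0, h.trans_le (abs_nonneg _)⟩
  · refine (isCompact_closedBall (0 : En n) (n * N ^ 2 + 1)).of_isClosed_subset
      (isClosed_cube N) fun x hx => ?_
    have := norm_le_of_mem_cube hx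
    rw [mem_closedBall_zero_iff]
    nlinarith [norm_nonneg x, sq_nonneg (‖x‖ - 1)]

lemma isCompact_box (N : ℝ) : IsCompact (box n N) := (isCompact_cube N).prod isCompact_Icc

lemma box_subset_halfSpace (N : ℝ) : box n N ⊆ halfSpace n :=
  fun _ hz => mem_halfSpace.2 hz.2.2

lemma volume_cube (N : ℝ) : volume (cube n N) = ENNReal.ofReal (2 * N) ^ n := by
  have : cube n N = (@WithLp.ofLp 2 (Fin n → ℝ)) ⁻¹' (univ.pi fun _ => Icc (-N) N) := by
    ext x; simp [cube, abs_le, Pi.le_def, forall_and]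
  rw [this, (PiLp.volume_preserving_ofLp (Fin n)).measure_preimage
    (MeasurableSet.univ_pi fun _ => measurableSet_Icc).nullMeasurableSet, volume_pi_pi]
  simp [two_mul]

lemma setLIntegral_cube_le {f : En n → ℝ} (hf0 : ∀ x, 0 < f x) (hfc : Continuous f)
    (hper : ∀ (x : En n) (i : Fin n), f (x + EuclideanSpace.single i 1) = f x)
    (havg : ∫ x in {x : En n | ∀ i, x i ∈ Set.Icc (0:ℝ) 1}, f x = 1) {N : ℕ} (hN : 1 ≤ N) :
    ∫⁻ x in cube n N, ENNReal.ofReal (f x) ≤ ENNReal.ofReal ((2 * N) ^ n) := by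
  set U : Set (En n) := {x : En n | ∀ i, x i ∈ Set.Icc (0:ℝ) 1} with hU
  have hUm : MeasurableSet U := by
    rw [hU, ofPred_forall]
    exact MeasurableSet.iInter fun i => measurableSet_Icc.preimage (by fun_prop)
  have hUc : U ⊆ cube n 1 := fun x hx i => abs_le.2 ⟨by linarith [(hx i).1], (hx i).2⟩
  have hval : ∫⁻ x in U, ENNReal.ofReal (f x) = 1 := by
    rw [← ofReal_integral_eq_lintegral_ofReal, havg, ENNReal.ofReal_one]
    · exact (hfc.continuousOn.integrableOn_compact (isCompact_cube 1)).mono_set hUc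
    · exact ae_of_all _ fun x => (hf0 x).le
  let V : (Fin n → ℤ) → En n := fun k => WithLp.toLp 2 fun i => (k i : ℝ)
  have htrans : ∀ k : Fin n → ℤ,
      ∫⁻ x in (fun x => x + V k) ⁻¹' U, ENNReal.ofReal (f x) = 1 := by
    intro k
    have hp : Function.Periodic f (V k) := periodic_of_forall_int hper fun i => ⟨k i, rfl⟩
    rw [← hval, ← (measurePreserving_add_right volume (V k)).setLIntegral_comp_preimage hUm
      hfc.measurable.ennreal_ofReal]
    exact lintegral_congr fun x => by rw [hp x]
  have hcover : cube n N ⊆ ⋃ k ∈ Fintype.piFinset fun _ : Fin n => Finset.Ioc (-N : ℤ) N,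
      (fun x => x + V k) ⁻¹' U := by
    intro x hx
    simp only [mem_iUnion, Fintype.mem_piFinset]
    refine ⟨fun i => if x i = N then -N + 1 else -⌊x i⌋, fun i => ?_, fun i => ?_⟩
    · have h1 := abs_le.1 (hx i)
      beta_reduce
      split_ifs with h
      · rw [Finset.mem_Ioc]; lia
      · have h2 : ⌊x i⌋ < N := Int.floor_lt.2 (by push_cast; exact lt_of_le_of_ne h1.2 h)
        have h3 : -(N:ℤ) ≤ ⌊x i⌋ := Int.le_floor.2 (by push_cast; exact h1.1)
        rw [Finset.mem_Ioc]; constructor <;> linarith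
    · by_cases h : x i = N
      · simp [V, h]
      · have h2 := Int.floor_le (x i)
        have h3 := Int.lt_floor_add_one (x i)
        simp only [V, h, if_false, PiLp.add_apply]
        push_cast
        constructor <;> linarith
  calc _ ≤ ∫⁻ x in ⋃ k ∈ Fintype.piFinset fun _ : Fin n => Finset.Ioc (-N : ℤ) N,
      (fun x => x + V k) ⁻¹' U, ENNReal.ofReal (f x) := lintegral_mono_set hcover
    _ ≤ _ := setLIntegral_biUnion_finset_le _ _ _ _
    _ = _ := by
      simp only [htrans, Finset.sum_const, Fintype.card_piFinset, Int.card_Ioc, Finset.prod_const,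
        Finset.card_univ, Fintype.card_fin, nsmul_eq_mul, mul_one]
      have : ((N:ℤ) - -N).toNat = 2 * N := by lia
      rw [this, ← ENNReal.ofReal_natCast]
      push_cast
      rfl

lemma setLIntegral_Icc_le {f : ℝ → ℝ} (hf0 : ∀ t ≤ 0, 0 < f t) (hfc : ContinuousOn f (Iic 0))
    (hper : ∀ t ≤ 0, f (t - 1) = f t) (havg : ∫ t in Set.Icc (-1:ℝ) 0, f t = 1)
    {N : ℕ} (hN : 1 ≤ N) :
    ∫⁻ t in Icc (-(N:ℝ)) 0, ENNReal.ofReal (f t) ≤ N := by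
  have hval : ∀ j : ℕ, ∫⁻ t in Icc (-((j:ℝ) + 1)) (-j), ENNReal.ofReal (f t) = 1 := by
    intro j
    induction j with
    | zero =>
      simp only [Nat.cast_zero, zero_add, neg_zero]
      rw [← ofReal_integral_eq_lintegral_ofReal, havg, ENNReal.ofReal_one]
      · exact (hfc.mono Icc_subset_Iic_self).integrableOn_compact isCompact_Icc
      · exact (ae_restrict_iff' measurableSet_Icc).2 (ae_of_all _ fun t ht => (hf0 t ht.2).le)
    | succ j ih =>
      rw [← ih, ← (measurePreserving_sub_right volume (1:ℝ)).setLIntegral_comp_preimage_emb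
        (MeasurableEquiv.subRight (1:ℝ)).measurableEmbedding]
      have : (fun t : ℝ => t - 1) ⁻¹' Icc (-(((j + 1 : ℕ):ℝ) + 1)) (-((j + 1 : ℕ) : ℝ)) =
          Icc (-((j:ℝ) + 1)) (-j) := by
        ext t; simp only [mem_preimage, mem_Icc]; push_cast
        constructor <;> rintro ⟨h1, h2⟩ <;> constructor <;> linarith
      rw [this]
      refine setLIntegral_congr_fun measurableSet_Icc fun t ht => ?_
      have : (0:ℝ) ≤ j := by positivity
      simp only [hper t (ht.2.trans (by linarith))]
  have hcover : Icc (-(N:ℝ)) 0 ⊆ ⋃ j ∈ Finset.range N, Icc (-((j:ℝ) + 1)) (-j) := by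
    intro t ht
    simp only [mem_iUnion, Finset.mem_range]
    have hN' : ((N - 1 : ℕ) : ℝ) = N - 1 := by push_cast [hN]; ring
    have h1 := Nat.floor_le (show 0 ≤ -t by linarith [ht.2])
    have h2 := Nat.lt_floor_add_one (-t)
    by_cases h : ⌊-t⌋₊ < N
    · exact ⟨_, h, by linarith, by linarith⟩
    · have h3 : (N : ℝ) ≤ ⌊-t⌋₊ := by exact_mod_cast not_lt.1 h
      exact ⟨N - 1, by lia, by rw [hN']; linarith [ht.1], by rw [hN']; linarith⟩
  calc _ ≤ _ := lintegral_mono_set hcover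
    _ ≤ _ := setLIntegral_biUnion_finset_le _ _ _ _
    _ = _ := by rw [Finset.sum_congr rfl fun j _ => hval j]; simp

lemma setLIntegral_box_le {f₁ : En n → ℝ} (hf0 : ∀ x, 0 < f₁ x) (hfc : Continuous f₁)
    (hper : ∀ (x : En n) (i : Fin n), f₁ (x + EuclideanSpace.single i 1) = f₁ x)
    (havg : ∫ x in {x : En n | ∀ i, x i ∈ Set.Icc (0:ℝ) 1}, f₁ x = 1)
    {f₂ : ℝ → ℝ} (hf0' : ∀ t ≤ 0, 0 < f₂ t) (hfc' : ContinuousOn f₂ (Iic 0))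
    (hper' : ∀ t ≤ 0, f₂ (t - 1) = f₂ t) (havg' : ∫ t in Set.Icc (-1:ℝ) 0, f₂ t = 1)
    {N : ℕ} (hN : 1 ≤ N) :
    ∫⁻ z in box n N, ENNReal.ofReal (f₁ z.1 * f₂ z.2) ≤
      ENNReal.ofReal ((2 * N) ^ n * N ^ 2) := by
  simp_rw [fun z : En n × ℝ => ENNReal.ofReal_mul (q := f₂ z.2) (hf0 z.1).le]
  rw [box, Measure.volume_eq_prod, ← Measure.prod_restrict, lintegral_prod_mul
    hfc.measurable.ennreal_ofReal.aemeasurable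
    ((hfc'.mono Icc_subset_Iic_self).aemeasurable measurableSet_Icc).ennreal_ofReal]
  have h2 := setLIntegral_Icc_le hf0' hfc' hper' havg' (N := N ^ 2) (Nat.one_le_pow _ _ hN)
  push_cast at h2
  rw [ENNReal.ofReal_mul (by positivity)]
  refine mul_le_mul' (setLIntegral_cube_le hf0 hfc hper havg hN) (h2.trans_eq ?_)
  rw [ENNReal.ofReal_pow (by positivity), ENNReal.ofReal_natCast]

/-- The linear operator on `ℝⁿ` with matrix `A`. -/
def op (A : Matrix (Fin n) (Fin n) ℝ) : En n →L[ℝ] En n := toEuclideanCLM (𝕜 := ℝ) A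

/-- The quadratic profile `½ xᵀAx - τt`. -/
def profile (A : Matrix (Fin n) (Fin n) ℝ) (τ : ℝ) (x : En n) (t : ℝ) : ℝ :=
  1 / 2 * ⟪x, op A x⟫ - τ * t

lemma inner_op (A : Matrix (Fin n) (Fin n) ℝ) (x y : En n) :
    ⟪x, op A y⟫ = x.ofLp ⬝ᵥ A *ᵥ y.ofLp := by
  simp [op, PiLp.inner_apply, dotProduct, mul_comm]

lemma inner_op_comm {A : Matrix (Fin n) (Fin n) ℝ} (hA : A.IsSymm) (x y : En n) :
    ⟪x, op A y⟫ = ⟪y, op A x⟫ := by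
  rw [inner_op, inner_op, dotProduct_mulVec, dotProduct_comm, ← Matrix.mulVec_transpose, hA]

lemma quadForm_eq_inner_op (A : Matrix (Fin n) (Fin n) ℝ) (x : En n) :
    quadForm A x = ⟪x, op A x⟫ := by
  simp [inner_op, quadForm, dotProduct, mulVec, Finset.mul_sum]
  refine Finset.sum_congr rfl fun i _ => Finset.sum_congr rfl fun j _ => by ring

lemma profile_add {A : Matrix (Fin n) (Fin n) ℝ} (hA : A.IsSymm) (τ : ℝ) (x e : En n) (s t : ℝ) :
    profile A τ (x + s • e) t =
      profile A τ x t + s * ⟪x, op A e⟫ + s ^ 2 / 2 * ⟪e, op A e⟫ := by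
  have := inner_op_comm hA e x
  simp only [profile, map_add, map_smul, inner_add_left, inner_add_right, inner_smul_left,
    inner_smul_right, this]
  simp
  ring

lemma exists_mul_sq_le_inner_op {A : Matrix (Fin n) (Fin n) ℝ} (hA : A.PosDef) :
    ∃ κ : ℝ, 0 < κ ∧ ∀ x : En n, κ * ‖x‖ ^ 2 ≤ ⟪x, op A x⟫ := by
  have hpos : 0 < ‖op A⁻¹‖ + 1 := by positivity
  refine ⟨(‖op A⁻¹‖ + 1)⁻¹, by positivity, fun x => ?_⟩
  rcases eq_or_ne x 0 with rfl | hx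
  · simp
  have h1 := sq_dotProduct_le_of_posDef hA x.ofLp x.ofLp
  rw [← inner_op, ← inner_op] at h1
  have h2 : x.ofLp ⬝ᵥ x.ofLp = ‖x‖ ^ 2 := by
    rw [EuclideanSpace.norm_sq_eq]; simp [dotProduct, sq]
  rw [h2] at h1
  have h3 : ⟪x, op A⁻¹ x⟫ ≤ (‖op A⁻¹‖ + 1) * ‖x‖ ^ 2 := by
    calc ⟪x, op A⁻¹ x⟫ ≤ ‖x‖ * ‖op A⁻¹ x‖ := real_inner_le_norm _ _
      _ ≤ ‖x‖ * (‖op A⁻¹‖ * ‖x‖) := by gcongr; exact (op A⁻¹).le_opNorm x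
      _ ≤ _ := by nlinarith [sq_nonneg ‖x‖]
  have hx0 : 0 < ‖x‖ ^ 2 := by positivity
  have h4 : 0 ≤ ⟪x, op A x⟫ := by
    rw [inner_op]; simpa using hA.posSemidef.dotProduct_mulVec_nonneg x.ofLp
  rw [inv_mul_le_iff₀ hpos]
  have : (‖x‖ ^ 2) * ‖x‖ ^ 2 ≤ ((‖op A⁻¹‖ + 1) * ⟪x, op A x⟫) * ‖x‖ ^ 2 := by
    nlinarith [mul_le_mul_of_nonneg_left h3 h4]
  exact le_of_mul_le_mul_right this hx0

/-- Entire parabolically convex solutions of `-u_t det D²u = f` with quadratic asymptotics. -/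
structure IsModelSolution (u : En n → ℝ → ℝ) (P : En n → ℝ → En n)
    (M : En n → ℝ → Matrix (Fin n) (Fin n) ℝ) (D : En n → ℝ → ℝ) (f : En n → ℝ → ℝ)
    (A : Matrix (Fin n) (Fin n) ℝ) (τ lam Λ γ : ℝ) : Prop where
  hasC21 : HasC21 u P M D
  conv : ∀ t ≤ 0, ConvexOn ℝ univ fun x => u x t
  posDef : ∀ x t, t ≤ 0 → (M x t).PosDef
  time_neg : ∀ x t, t ≤ 0 → D x t < 0
  eqn : ∀ x t, t ≤ 0 → -D x t * (M x t).det = f x t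
  lam_pos : 0 < lam
  lam_le : ∀ x t, t ≤ 0 → lam ≤ f x t
  le_Λ : ∀ x t, t ≤ 0 → f x t ≤ Λ
  lintegral_le : ∀ N : ℕ, 1 ≤ N →
    ∫⁻ z in box n N, ENNReal.ofReal (f z.1 z.2) ≤ ENNReal.ofReal ((2 * N) ^ n * N ^ 2)
  posDef_A : A.PosDef
  symm_A : A.IsSymm
  τ_pos : 0 < τ
  τ_mul_det : τ * A.det = 1
  γ_pos : 0 < γ
  γ_lt : γ < 1
  asymp : ∃ C : ℝ, ∀ x t, t ≤ 0 → |u x t - profile A τ x t| ≤ C * (1 + (‖x‖ ^ 2 - t)) ^ γ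

namespace IsModelSolution

variable {u : En n → ℝ → ℝ} {P : En n → ℝ → En n} {M : En n → ℝ → Matrix (Fin n) (Fin n) ℝ}
  {D f : En n → ℝ → ℝ} {A : Matrix (Fin n) (Fin n) ℝ} {τ lam Λ γ : ℝ}

lemma asymp_linear (h : IsModelSolution u P M D f A τ lam Λ γ) {ν : ℝ} (hν : 0 < ν) :
    ∃ C : ℝ, 0 < C ∧ ∀ x t, t ≤ 0 → |u x t - profile A τ x t| ≤ ν * (‖x‖ ^ 2 - t) + C := by
  obtain ⟨C, hC⟩ := h.asymp
  have hlim : Tendsto (fun r : ℝ => (|C| + 1) * r ^ (-(1 - γ))) atTop (𝓝 ((|C| + 1) * 0)) :=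
    (tendsto_rpow_neg_atTop (by linarith [h.γ_lt])).const_mul _
  rw [mul_zero] at hlim
  obtain ⟨R, hR⟩ := eventually_atTop.1 ((hlim.eventually (gt_mem_nhds hν)).and
    (eventually_ge_atTop 1))
  have hR1 : 1 ≤ R := (hR R le_rfl).2
  have key : ∀ r : ℝ, 1 ≤ r → C * r ^ γ ≤ ν * r + (|C| + 1) * R ^ γ := by
    intro r hr
    have hr0 : 0 < r := by linarith
    have h1 : C * r ^ γ ≤ (|C| + 1) * r ^ γ := by
      gcongr
      linarith [le_abs_self C]
    rcases le_total R r with h2 | h2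
    · have h3 := (hR r h2).1
      have : (|C| + 1) * r ^ γ = ((|C| + 1) * r ^ (-(1 - γ))) * r := by
        rw [mul_assoc, ← Real.rpow_add_one hr0.ne']; ring_nf
      have h4 : 0 ≤ (|C| + 1) * R ^ γ := by positivity
      nlinarith
    · have : r ^ γ ≤ R ^ γ := Real.rpow_le_rpow hr0.le h2 h.γ_pos.le
      have h5 : (|C| + 1) * r ^ γ ≤ (|C| + 1) * R ^ γ := by gcongr
      have : 0 ≤ ν * r := by positivity
      linarith
  refine ⟨ν + (|C| + 1) * R ^ γ, by positivity, fun x t ht => (hC x t ht).trans ?_⟩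
  have := key (1 + (‖x‖ ^ 2 - t)) (by nlinarith [sq_nonneg ‖x‖])
  linarith

lemma exists_profile_ge (h : IsModelSolution u P M D f A τ lam Λ γ) :
    ∃ κ : ℝ, 0 < κ ∧ ∀ x t, t ≤ 0 → κ * (‖x‖ ^ 2 - t) ≤ profile A τ x t := by
  obtain ⟨κ, hκ, hA⟩ := exists_mul_sq_le_inner_op h.posDef_A
  refine ⟨min (κ / 2) τ, lt_min (by linarith) h.τ_pos, fun x t ht => ?_⟩
  have h1 := hA x
  have h2 : min (κ / 2) τ * ‖x‖ ^ 2 ≤ κ / 2 * ‖x‖ ^ 2 := by gcongr; exact min_le_left _ _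
  have h3 : min (κ / 2) τ * (-t) ≤ τ * (-t) := by
    have : 0 ≤ -t := by linarith
    gcongr; exact min_le_right _ _
  unfold profile
  linarith

lemma exists_ge (h : IsModelSolution u P M D f A τ lam Λ γ) :
    ∃ κ C : ℝ, 0 < κ ∧ 0 < C ∧ ∀ x t, t ≤ 0 → κ * (‖x‖ ^ 2 - t) - C ≤ u x t := by
  obtain ⟨κ, hκ, hA⟩ := h.exists_profile_ge
  obtain ⟨C, hC0, hC⟩ := h.asymp_linear (half_pos hκ)
  refine ⟨κ / 2, C, half_pos hκ, hC0, fun x t ht => ?_⟩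
  have h1 := hA x t ht
  have h2 := (abs_le.1 (hC x t ht)).1
  linarith

/-- The linearized operator at `u` is nonnegative on `u(· + e) - u`, up to normalization. -/
lemma le_trace_translate (h : IsModelSolution u P M D f A τ lam Λ γ) {e : En n}
    (he : ∀ x t, t ≤ 0 → f (x + e) t = f x t) {x : En n} {t : ℝ} (ht : t ≤ 0) :
    (n : ℝ) + 1 ≤ ((M x t)⁻¹ * M (x + e) t).trace + (-D (x + e) t) / (-D x t) :=
  le_trace_inv_mul_add_div (h.posDef x t ht) (h.posDef _ t ht)
    (by linarith [h.time_neg x t ht]) (by linarith [h.time_neg (x + e) t ht])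
    (by rw [h.eqn _ _ ht, h.eqn _ _ ht, he _ _ ht])

lemma inv_mul_self_trace (h : IsModelSolution u P M D f A τ lam Λ γ) {x : En n} {t : ℝ}
    (ht : t ≤ 0) : ((M x t)⁻¹ * M x t).trace = n := by
  rw [Matrix.nonsing_inv_mul _ (h.posDef x t ht).det_pos.ne'.isUnit]; simp

end IsModelSolution

/-- The increment of `u` along `e`, corrected by the increment of the quadratic profile. -/
def incr (u : En n → ℝ → ℝ) (A : Matrix (Fin n) (Fin n) ℝ) (e x : En n) (t : ℝ) : ℝ :=
  u (x + e) t - u x t - ⟪x, op A e⟫ - 1 / 2 * ⟪e, op A e⟫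

lemma norm_add_smul_sq_le (x e : En n) (s : ℝ) :
    ‖x + s • e‖ ^ 2 ≤ 2 * ‖x‖ ^ 2 + 2 * s ^ 2 * ‖e‖ ^ 2 := by
  have h1 := norm_add_le x (s • e)
  rw [norm_smul] at h1
  have h2 : ‖x + s • e‖ ^ 2 ≤ (‖x‖ + ‖s‖ * ‖e‖) ^ 2 := by gcongr
  have h3 : ‖s‖ ^ 2 = s ^ 2 := by rw [Real.norm_eq_abs, sq_abs]
  nlinarith [sq_nonneg (‖x‖ - ‖s‖ * ‖e‖)]

lemma mul_sub_le_of_convexOn {φ : En n → ℝ} (hφ : ConvexOn ℝ univ φ) (x e : En n) {s : ℝ}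
    (hs : 1 ≤ s) : s * (φ (x + e) - φ x) ≤ φ (x + s • e) - φ x := by
  have hs0 : 0 < s := by linarith
  have h1 := hφ.2 (mem_univ x) (mem_univ (x + s • e))
    (show 0 ≤ 1 - 1 / s by rw [sub_nonneg, div_le_one hs0]; exact hs)
    (show 0 ≤ 1 / s by positivity) (by ring)
  have h2 : (1 - 1 / s) • x + (1 / s) • (x + s • e) = x + e := by
    rw [smul_add, smul_smul, one_div_mul_cancel hs0.ne', sub_smul]; simp; abel
  rw [h2] at h1
  have h3 := mul_le_mul_of_nonneg_left h1 hs0.le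
  have h4 : s * ((1 - 1 / s) • φ x + (1 / s) • φ (x + s • e)) =
      s * φ x - φ x + φ (x + s • e) := by
    simp only [smul_eq_mul]; field_simp
  linarith

lemma le_mul_sub_of_convexOn {φ : En n → ℝ} (hφ : ConvexOn ℝ univ φ) (x e : En n) {s : ℝ}
    (hs : 1 ≤ s) : φ x - φ (x + (-s) • e) ≤ s * (φ (x + e) - φ x) := by
  have hs0 : 0 < s + 1 := by linarith
  have h1 := hφ.2 (mem_univ (x + e)) (mem_univ (x + (-s) • e)) 
    (show 0 ≤ s / (s + 1) by positivity) (show 0 ≤ 1 / (s + 1) by positivity) (by field_simp)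
  have h2 : (s / (s + 1)) • (x + e) + (1 / (s + 1)) • (x + (-s) • e) = x := by
    ext i
    simp only [PiLp.add_apply, PiLp.smul_apply, smul_eq_mul]
    field_simp; ring
  rw [h2] at h1
  have h3 := mul_le_mul_of_nonneg_left h1 hs0.le
  have h4 : (s + 1) * ((s / (s + 1)) • φ (x + e) + (1 / (s + 1)) • φ (x + (-s) • e)) =
      s * φ (x + e) + φ (x + (-s) • e) := by
    simp only [smul_eq_mul]; field_simp
  linarith

namespace IsModelSolution

variable {u : En n → ℝ → ℝ} {P : En n → ℝ → En n} {M : En n → ℝ → Matrix (Fin n) (Fin n) ℝ}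
  {D f : En n → ℝ → ℝ} {A : Matrix (Fin n) (Fin n) ℝ} {τ lam Λ γ : ℝ}

lemma inner_op_nonneg (h : IsModelSolution u P M D f A τ lam Λ γ) (e : En n) :
    0 ≤ ⟪e, op A e⟫ := by
  rw [inner_op]; simpa using h.posDef_A.posSemidef.dotProduct_mulVec_nonneg e.ofLp

lemma abs_incr_le (h : IsModelSolution u P M D f A τ lam Λ γ) (e : En n) {ν : ℝ} (hν : 0 < ν) :
    ∃ C : ℝ, 0 < C ∧ ∀ x t, t ≤ 0 → |incr u A e x t| ≤ ν * √(‖x‖ ^ 2 - t) + C := by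
  set c := ⟪e, op A e⟫ with hc
  have hc0 : 0 ≤ c := h.inner_op_nonneg e
  set E := ‖e‖ ^ 2 with hE
  have hE0 : 0 ≤ E := by positivity
  set σ := min 1 (ν / (c / 2 + 3 + 2 * E)) with hσ
  have hden : 0 < c / 2 + 3 + 2 * E := by positivity
  have hσ0 : 0 < σ := lt_min one_pos (by positivity)
  have hσ1 : σ ≤ 1 := min_le_left _ _
  have hσν : σ * (c / 2 + 3 + 2 * E) ≤ ν := (le_div_iff₀ hden).1 (min_le_right _ _)
  obtain ⟨C, hC0, hC⟩ := h.asymp_linear (pow_pos hσ0 2)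
  refine ⟨c + 2 * E + 2 * C, by positivity, fun x t ht => ?_⟩
  have hρ : 0 ≤ ‖x‖ ^ 2 - t := by nlinarith [sq_nonneg ‖x‖]
  set R := √(‖x‖ ^ 2 - t) with hR
  have hR0 : 0 ≤ R := Real.sqrt_nonneg _
  have hR2 : R ^ 2 = ‖x‖ ^ 2 - t := Real.sq_sqrt hρ
  set s := 1 + σ * R with hs
  have hs1 : 1 ≤ s := by have : 0 ≤ σ * R := by positivity
                         linarith
  have hs0 : 0 < s := by linarith
  have hw : ∀ r : ℝ, r ^ 2 = s ^ 2 →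
      |u (x + r • e) t - profile A τ (x + r • e) t| ≤ σ ^ 2 * (2 * R ^ 2 + 2 * s ^ 2 * E) + C := by
    intro r hr
    refine (hC _ t ht).trans ?_
    have := norm_add_smul_sq_le x e r
    rw [hr] at this
    gcongr
    rw [hR2]
    linarith
  have hw0 := hC x t ht
  rw [← hR2] at hw0
  have hu := hw s rfl
  have hl := hw (-s) (by ring)
  rw [profile_add h.symm_A] at hu hl
  rw [← hc] at hu hl
  have hsu := mul_sub_le_of_convexOn (h.conv t ht) x e hs1
  have hsl := le_mul_sub_of_convexOn (h.conv t ht) x e hs1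
  have b1 : 3 * (σ ^ 2 * R ^ 2) ≤ s * (3 * σ * R) := by
    have : σ * R ≤ s := by linarith
    nlinarith [mul_nonneg hσ0.le hR0]
  have b2 : 2 * σ ^ 2 * s ^ 2 * E ≤ s * (2 * E + 2 * σ * E * R) := by
    have h1 : σ ^ 2 * s ≤ 1 + σ * R := by
      rw [← hs]; exact mul_le_of_le_one_left hs0.le (pow_le_one₀ hσ0.le hσ1)
    have h2 : σ ^ 2 * s * (2 * s * E) ≤ (1 + σ * R) * (2 * s * E) := by gcongr
    linarith
  have b3 : 2 * C ≤ s * (2 * C) := by nlinarith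
  have b4 : s * (σ * R * (c / 2 + 3 + 2 * E)) ≤ s * (ν * R) := by
    have : σ * R * (c / 2 + 3 + 2 * E) ≤ ν * R := by nlinarith
    gcongr
  have hsi : s * incr u A e x t =
      s * (u (x + e) t - u x t) - s * ⟪x, op A e⟫ - s * c / 2 := by
    rw [incr]; ring
  rw [abs_le] at hu hl hw0 ⊢
  have hss : s ^ 2 * c = s * c + s * (σ * R * c) := by rw [hs]; ring
  have hsc := mul_nonneg hs0.le hc0
  constructor
  · refine le_of_mul_le_mul_left (a := s) ?_ hs0
    rw [hsi]
    linarith [hu.1, hu.2, hl.1, hl.2, hw0.1, hw0.2]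
  · refine le_of_mul_le_mul_left (a := s) ?_ hs0
    rw [hsi]
    linarith [hu.1, hu.2, hl.1, hl.2, hw0.1, hw0.2]

lemma hasC21_incr (h : IsModelSolution u P M D f A τ lam Λ γ) (e : En n) (b : ℝ) :
    HasC21 (fun x t => incr u A e x t + b) (fun x t => P (x + e) t - P x t - op A e)
      (fun x t => M (x + e) t - M x t) (fun x t => D (x + e) t - D x t) := by
  have := ((h.hasC21.translate e).add (h.hasC21.const_mul (-1))).add
    (HasC21.affine (-op A e) (b - 1 / 2 * ⟪e, op A e⟫))
  convert this using 1
  · funext x t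
    rw [incr, inner_neg_left, real_inner_comm x]; ring
  · funext x t
    rw [neg_one_smul]; abel
  · funext x t
    rw [neg_one_smul]; abel
  · funext x t; ring

lemma contact_barrier (h : IsModelSolution u P M D f A τ lam Λ γ) {e : En n}
    (he : ∀ x t, t ≤ 0 → f (x + e) t = f x t) {k G : ℝ} (hk : 0 ≤ k) (hG : 0 ≤ G)
    {x : En n} {t : ℝ} (ht : t ≤ 0) {g : Fin n → ℝ}
    (hζ : 0 ≤ -1 * D x t + k * (2 * G * (D (x + e) t - D x t)))
    (hZ : (-((-1 : ℝ) • M x t +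
      k • ((2 * G) • (M (x + e) t - M x t) + (2 : ℝ) • vecMulVec g g))).PosSemidef) :
    (-1 * D x t + k * (2 * G * (D (x + e) t - D x t))) *
      (-((-1 : ℝ) • M x t +
        k • ((2 * G) • (M (x + e) t - M x t) + (2 : ℝ) • vecMulVec g g))).det ≤ f x t ∧
    2 * k * (g ⬝ᵥ (M x t)⁻¹ *ᵥ g) ≤ n + 1 := by
  set Z := -((-1 : ℝ) • M x t +
      k • ((2 * G) • (M (x + e) t - M x t) + (2 : ℝ) • vecMulVec g g)) with hZdef
  set ζ := -1 * D x t + k * (2 * G * (D (x + e) t - D x t)) with hζdef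
  have hp : 0 < -D x t := by linarith [h.time_neg x t ht]
  have hN := h.posDef x t ht
  have hL := h.le_trace_translate he (x := x) ht
  have hn := h.inv_mul_self_trace (x := x) ht
  set Y := ((M x t)⁻¹ * M (x + e) t).trace with hY
  have htr : ((M x t)⁻¹ * Z).trace =
      n - k * (2 * G * (Y - n) + 2 * (g ⬝ᵥ (M x t)⁻¹ *ᵥ g)) := by
    rw [← trace_inv_mul_vecMulVec, hZdef]
    simp only [mul_neg, mul_add, mul_sub, Matrix.mul_smul, trace_neg, trace_add, trace_sub,
      trace_smul, smul_eq_mul, hn, ← hY]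
    ring
  have hζp : ζ / (-D x t) = 1 - k * (2 * G * ((-D (x + e) t) / (-D x t) - 1)) := by
    have hne : D x t ≠ 0 := (h.time_neg x t ht).ne
    rw [hζdef]; field_simp; ring
  have hg : 0 ≤ g ⬝ᵥ (M x t)⁻¹ *ᵥ g := by
    simpa using hN.inv.posSemidef.dotProduct_mulVec_nonneg g
  have hkG : 0 ≤ k * (2 * G) * (Y + (-D (x + e) t) / (-D x t) - (n + 1)) := by
    apply mul_nonneg (by positivity); linarith
  have htot : ((M x t)⁻¹ * Z).trace + ζ / (-D x t) ≤
      (n + 1) - 2 * k * (g ⬝ᵥ (M x t)⁻¹ *ᵥ g) := by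
    rw [htr, hζp]; linarith
  constructor
  · have := mul_det_le_of_trace_le hN hZ hp hζ (κ := 1) (by
      have : 0 ≤ 2 * k * (g ⬝ᵥ (M x t)⁻¹ *ᵥ g) := by positivity
      linarith)
    rwa [one_pow, one_mul, h.eqn x t ht] at this
  · have h1 := trace_inv_mul_nonneg hN hZ
    have h2 : 0 ≤ ζ / (-D x t) := by positivity
    linarith

/-- The barrier is uniformly close to the negative of the quadratic profile. -/
lemma exists_barrier_close (h : IsModelSolution u P M D f A τ lam Λ γ) (e : En n) {k ν : ℝ}
    (hk : 0 < k) (hν : 0 < ν) :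
    ∃ σ : ℝ, 0 < σ ∧ ∃ N₀ : ℝ, ∀ N : ℝ, N₀ ≤ N →
      (∀ x t, t ≤ 0 →
        |-1 * u x t + k * (incr u A e x t + σ * N) ^ 2 + profile A τ x t| ≤
          ν * (‖x‖ ^ 2 - t + N ^ 2)) ∧
      ∀ z ∈ box n (2 * N), 0 ≤ incr u A e z.1 z.2 + σ * N := by
  obtain ⟨σ, hσ0, hσ⟩ : ∃ σ : ℝ, 0 < σ ∧ 3 * k * σ ^ 2 ≤ ν / 2 := by
    refine ⟨√(ν / (6 * k)), by positivity, ?_⟩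
    rw [Real.sq_sqrt (by positivity)]
    apply le_of_eq; field_simp; ring
  set δ := min σ (σ / (4 * (n + 1))) with hδ
  have hδ0 : 0 < δ := lt_min hσ0 (by positivity)
  obtain ⟨C, hC0, hC⟩ := h.asymp_linear (half_pos hν)
  obtain ⟨C', hC'0, hC'⟩ := h.abs_incr_le e hδ0
  refine ⟨σ, hσ0, 1 + (C + 3 * k * C' ^ 2) / (ν / 2) + 2 * C' / σ, fun N hN => ?_⟩
  have hN1 : 1 ≤ N := by
    have h1 : 0 ≤ (C + 3 * k * C' ^ 2) / (ν / 2) := by positivity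
    have h2 : 0 ≤ 2 * C' / σ := by positivity
    linarith
  have hNC : C + 3 * k * C' ^ 2 ≤ ν / 2 * N := by
    have h2 : 0 ≤ 2 * C' / σ := by positivity
    have : (C + 3 * k * C' ^ 2) / (ν / 2) ≤ N := by linarith
    rwa [div_le_iff₀' (by positivity)] at this
  have hNC' : 2 * C' ≤ σ * N := by
    have h1 : 0 ≤ (C + 3 * k * C' ^ 2) / (ν / 2) := by positivity
    have : 2 * C' / σ ≤ N := by linarith
    rwa [div_le_iff₀' (by positivity)] at this
  refine ⟨fun x t ht => ?_, fun z hz => ?_⟩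
  · have hρ : 0 ≤ ‖x‖ ^ 2 - t := by nlinarith [sq_nonneg ‖x‖]
    set R := √(‖x‖ ^ 2 - t) with hR
    have hR0 : 0 ≤ R := Real.sqrt_nonneg _
    have hR2 : R ^ 2 = ‖x‖ ^ 2 - t := Real.sq_sqrt hρ
    have h1 := hC x t ht
    have h2 := hC' x t ht
    set g := incr u A e x t
    rw [← hR2] at h1 ⊢
    have h3 : (g + σ * N) ^ 2 ≤ 3 * σ ^ 2 * R ^ 2 + 3 * C' ^ 2 + 3 * σ ^ 2 * N ^ 2 := by
      have h4 : |g + σ * N| ≤ σ * R + C' + σ * N := by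
        refine (abs_add_le _ _).trans ?_
        rw [abs_of_nonneg (show 0 ≤ σ * N by positivity)]
        have : δ * R ≤ σ * R := by gcongr; exact min_le_left _ _
        linarith
      calc (g + σ * N) ^ 2 = |g + σ * N| ^ 2 := (sq_abs _).symm
        _ ≤ (σ * R + C' + σ * N) ^ 2 := by gcongr
        _ ≤ _ := by nlinarith [sq_nonneg (σ * R - C'), sq_nonneg (σ * R - σ * N),
                      sq_nonneg (C' - σ * N)]
    have h5 : k * (g + σ * N) ^ 2 ≤
        k * (3 * σ ^ 2 * R ^ 2 + 3 * C' ^ 2 + 3 * σ ^ 2 * N ^ 2) := by gcongr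
    have h6 : 0 ≤ k * (g + σ * N) ^ 2 := by positivity
    have h7 : 3 * k * σ ^ 2 * R ^ 2 ≤ ν / 2 * R ^ 2 := by gcongr
    have h8 : 3 * k * σ ^ 2 * N ^ 2 ≤ ν / 2 * N ^ 2 := by gcongr
    have h9 : ν / 2 * N ≤ ν / 2 * N ^ 2 := by gcongr; nlinarith
    have h10 : 0 ≤ 3 * k * C' ^ 2 := by positivity
    rw [abs_le] at h1 ⊢
    constructor <;> nlinarith
  · have ht : z.2 ≤ 0 := hz.2.2
    have h1 := (abs_le.1 (hC' z.1 z.2 ht)).1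
    have h2 : √(‖z.1‖ ^ 2 - z.2) ≤ 2 * (n + 1) * N := by
      rw [Real.sqrt_le_iff]
      refine ⟨by positivity, ?_⟩
      have h3 := norm_le_of_mem_cube hz.1
      have h4 := hz.2.1
      have hn : (0:ℝ) ≤ n := by positivity
      nlinarith [mul_nonneg hn (sq_nonneg N), mul_nonneg (mul_nonneg hn hn) (sq_nonneg N)]
    have h5 : δ * √(‖z.1‖ ^ 2 - z.2) ≤ σ / (4 * (n + 1)) * (2 * (n + 1) * N) := by
      gcongr; exact min_le_right _ _
    have h6 : σ / (4 * (n + 1)) * (2 * (n + 1) * N) = σ * N / 2 := by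
      field_simp; ring
    linarith

end IsModelSolution

/-- The contact parameters `(-Ay, ½ yᵀAy + τs)` for `y` in a cube and `s` in an interval. -/
def contactParams (A : Matrix (Fin n) (Fin n) ℝ) (τ N a b : ℝ) : Set (En n × ℝ) :=
  (fun w : En n × ℝ => (-op A w.1, 1 / 2 * ⟪w.1, op A w.1⟫ + τ * w.2)) '' (cube n N ×ˢ Icc a b)

lemma le_volume_contactParams {A : Matrix (Fin n) (Fin n) ℝ} {τ N a b : ℝ} (hτ : 0 < τ)
    (hdet : τ * A.det = 1) (hN : 0 ≤ N) (hab : a ≤ b) :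
    ENNReal.ofReal ((2 * N) ^ n * (b - a)) ≤ volume (contactParams A τ N a b) := by
  have hc : IsCompact (contactParams A τ N a b) :=
    ((isCompact_cube N).prod isCompact_Icc).image (by fun_prop)
  rw [Measure.volume_eq_prod, Measure.prod_apply hc.measurableSet]
  have hslice : ∀ p ∈ (-op A) '' cube n N, ENNReal.ofReal (τ * (b - a)) ≤
      volume (Prod.mk p ⁻¹' contactParams A τ N a b) := by
    rintro _ ⟨y, hy, rfl⟩
    have hsub : Icc (1 / 2 * ⟪y, op A y⟫ + τ * a) (1 / 2 * ⟪y, op A y⟫ + τ * b) ⊆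
        Prod.mk ((-op A) y) ⁻¹' contactParams A τ N a b := by
      intro η hη
      refine ⟨(y, (η - 1 / 2 * ⟪y, op A y⟫) / τ), ⟨hy, ?_, ?_⟩, ?_⟩
      · rw [le_div_iff₀' hτ]; linarith [hη.1]
      · rw [div_le_iff₀' hτ]; linarith [hη.2]
      · simp only [_root_.neg_apply, Prod.mk.injEq, true_and]
        field_simp; ring
    refine le_trans (le_of_eq ?_) (measure_mono hsub)
    rw [Real.volume_Icc]; congr 1; ring
  have hm : MeasurableSet ((-op A) '' cube n N) :=
    ((isCompact_cube N).image (-op A).continuous).measurableSet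
  have hA0 : 0 ≤ A.det := by
    by_contra! hcon
    nlinarith
  have hdetop : |LinearMap.det ((-op A : En n →L[ℝ] En n) : En n →ₗ[ℝ] En n)| = A.det := by
    have h1 : (-op A : En n →L[ℝ] En n) = toEuclideanCLM (𝕜 := ℝ) (-A) := by
      rw [op, map_neg]
    rw [h1]
    have h2 := det_toEuclideanCLM (-A)
    have h3 : (toEuclideanCLM (𝕜 := ℝ) (-A)).det = (-A).det := h2
    rw [ContinuousLinearMap.det] at h3
    rw [h3, det_neg, abs_mul, abs_of_nonneg hA0]
    simp
  calc ENNReal.ofReal ((2 * N) ^ n * (b - a))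
      = ENNReal.ofReal (τ * (b - a)) * volume ((-op A) '' cube n N) := by
        rw [Measure.addHaar_image_continuousLinearMap, hdetop, volume_cube,
          ← ENNReal.ofReal_pow (by positivity), ← ENNReal.ofReal_mul hA0,
          ← ENNReal.ofReal_mul (mul_nonneg hτ.le (sub_nonneg.2 hab))]
        congr 1
        linear_combination (-(2 * N) ^ n * (b - a)) * hdet
    _ = ∫⁻ _p in (-op A) '' cube n N, ENNReal.ofReal (τ * (b - a)) := by
        rw [setLIntegral_const]
    _ ≤ ∫⁻ p in (-op A) '' cube n N, volume (Prod.mk p ⁻¹' contactParams A τ N a b) :=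
        setLIntegral_mono' hm hslice
    _ ≤ _ := setLIntegral_le_lintegral _ _

lemma profile_sub_inner {A : Matrix (Fin n) (Fin n) ℝ} (hA : A.IsSymm) (τ : ℝ) (x y : En n)
    (t : ℝ) : -profile A τ x t - ⟪-op A y, x⟫ =
      -(1 / 2 * ⟪x - y, op A (x - y)⟫) + τ * t + 1 / 2 * ⟪y, op A y⟫ := by
  have h1 := inner_op_comm hA y x
  rw [inner_neg_left, real_inner_comm, profile, map_sub, inner_sub_left, inner_sub_right,
    inner_sub_right, h1]
  ring

/-- If `Φ` is close to `-(½ xᵀAx - τt)`, the contact point with parameters coming from `(y, s)`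
is close to `(y, s)`. -/
lemma contact_near {A : Matrix (Fin n) (Fin n) ℝ} (hA : A.IsSymm) {τ κ ν N : ℝ} (hτ : 0 < τ)
    (hκA : ∀ x : En n, κ * ‖x‖ ^ 2 ≤ ⟪x, op A x⟫) (hν : 0 < ν)
    (hνκ : ν ≤ κ / 8) (hντ : ν ≤ τ / 2) {Φ : En n → ℝ → ℝ}
    (hΦ : ∀ x t, t ≤ 0 → |Φ x t + profile A τ x t| ≤ ν * (‖x‖ ^ 2 - t + N ^ 2))
    {y : En n} (hy : y ∈ cube n N) {s : ℝ} (hs : -N ^ 2 ≤ s)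
    {x : En n} {t : ℝ} (ht : t ≤ 0)
    (heq : Φ x t - ⟪-op A y, x⟫ = 1 / 2 * ⟪y, op A y⟫ + τ * s)
    (hmax : Φ y t - ⟪-op A y, y⟫ ≤ 1 / 2 * ⟪y, op A y⟫ + τ * s) :
    κ / 4 * ‖x - y‖ ^ 2 ≤ ν * ((3 * n + 4) * N ^ 2) ∧
      τ / 2 * (s - t) ≤ ν * ((3 * n + 4) * N ^ 2) := by
  have hyN := norm_le_of_mem_cube hy
  have h1 := (abs_le.1 (hΦ x t ht)).2
  have h2 := (abs_le.1 (hΦ y t ht)).1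
  have e1 := profile_sub_inner hA τ x y t
  have e2 := profile_sub_inner hA τ y y t
  rw [sub_self, map_zero, inner_zero_left] at e2
  have h3 := hκA (x - y)
  have h4 : ‖x‖ ^ 2 ≤ 2 * ‖x - y‖ ^ 2 + 2 * ‖y‖ ^ 2 := by
    have h5 : ‖x‖ ≤ ‖x - y‖ + ‖y‖ := by simpa using norm_add_le (x - y) y
    have h6 : ‖x‖ ^ 2 ≤ (‖x - y‖ + ‖y‖) ^ 2 := by gcongr
    nlinarith [sq_nonneg (‖x - y‖ - ‖y‖)]
  have i1 : κ / 2 * ‖x - y‖ ^ 2 + τ * (s - t) ≤ ν * (‖x‖ ^ 2 - t + N ^ 2) := by linarith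
  have i2 : τ * (t - s) ≤ ν * (‖y‖ ^ 2 - t + N ^ 2) := by linarith
  have hn : (0:ℝ) ≤ n := by positivity
  have hnN : 0 ≤ n * N ^ 2 := by positivity
  have hN2 : 0 ≤ N ^ 2 := by positivity
  have hd : 0 ≤ ‖x - y‖ ^ 2 := by positivity
  have j1 : ν * ‖x - y‖ ^ 2 ≤ κ / 8 * ‖x - y‖ ^ 2 := by gcongr
  rcases le_total t s with hts | hts
  · have j2 : ν * (s - t) ≤ τ / 2 * (s - t) := by
      have : 0 ≤ s - t := by linarith
      gcongr
    have j3 : ν * (‖x‖ ^ 2 - t + N ^ 2) ≤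
        ν * (2 * ‖x - y‖ ^ 2 + (s - t) + (2 * n + 2) * N ^ 2) := by
      refine mul_le_mul_of_nonneg_left ?_ hν.le; linarith
    have j4 : ν * ((2 * n + 2) * N ^ 2) ≤ ν * ((3 * n + 4) * N ^ 2) := by
      refine mul_le_mul_of_nonneg_left ?_ hν.le; linarith
    have hκd : 0 ≤ κ / 4 * ‖x - y‖ ^ 2 := by
      have : 0 ≤ κ := by linarith
      positivity
    have hτd : 0 ≤ τ / 2 * (s - t) := mul_nonneg (by positivity) (by linarith)
    constructor <;> linarith
  · have j3 : ν * (‖x‖ ^ 2 - t + N ^ 2) ≤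
        ν * (2 * ‖x - y‖ ^ 2 + (2 * n + 2) * N ^ 2) := by
      refine mul_le_mul_of_nonneg_left ?_ hν.le; linarith
    have j4 : ν * (‖y‖ ^ 2 - t + N ^ 2) ≤ ν * ((n + 2) * N ^ 2) := by
      refine mul_le_mul_of_nonneg_left ?_ hν.le; linarith
    have j5 : τ / 2 * (s - t) ≤ 0 := mul_nonpos_of_nonneg_of_nonpos (by positivity) (by linarith)
    have j6 : 0 ≤ ν * ((3 * n + 4) * N ^ 2) := by positivity
    constructor <;> linarith

lemma box_subset_box {N N' : ℝ} (hN : 0 ≤ N) (h : N ≤ N') : box n N ⊆ box n N' := by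
  rintro z ⟨h1, h2, h3⟩
  refine ⟨fun i => (h1 i).trans h, ?_, h3⟩
  have : N ^ 2 ≤ N' ^ 2 := by gcongr
  linarith

lemma mem_box_of_near {N μ : ℝ} (hμ : 0 ≤ μ) {y x : En n} {s t : ℝ}
    (hy : y ∈ cube n N) (hs : -N ^ 2 ≤ s) (ht : t ≤ 0) (hxy : ‖x - y‖ ≤ μ * N)
    (hst : s - t ≤ (μ * N) ^ 2) : (x, t) ∈ box n ((1 + μ) * N) := by
  refine ⟨fun i => ?_, ?_, ht⟩
  · have h1 := hy i
    have h2 : |(x - y) i| ≤ ‖x - y‖ := by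
      simpa using PiLp.norm_apply_le (x - y) i
    have h3 : x i = y i + (x - y) i := by simp
    have h4 := abs_add_le (y i) ((x - y) i)
    rw [← h3] at h4
    linarith
  · show -((1 + μ) * N) ^ 2 ≤ t
    nlinarith [mul_nonneg hμ (sq_nonneg N)]

lemma exists_widening (n : ℕ) {η : ℝ} (hη : 0 < η) :
    ∃ μ : ℝ, 0 < μ ∧ μ ≤ 1 ∧ (1 + 2 * μ) ^ (n + 2) - 1 < η := by
  have hc : Tendsto (fun μ : ℝ => (1 + 2 * μ) ^ (n + 2) - 1) (𝓝[>] 0) (𝓝 0) := by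
    have : Continuous fun μ : ℝ => (1 + 2 * μ) ^ (n + 2) - 1 := by fun_prop
    have h := this.tendsto 0
    simp only [mul_zero, add_zero, one_pow, sub_self] at h
    exact h.mono_left nhdsWithin_le_nhds
  have h1 := hc.eventually (gt_mem_nhds hη)
  have h2 : ∀ᶠ μ : ℝ in 𝓝[>] 0, μ ∈ Ioc (0:ℝ) 1 := Ioc_mem_nhdsGT one_pos
  obtain ⟨μ, h3, h4⟩ := (h1.and h2).exists
  exact ⟨μ, h4.1, h4.2, h3⟩

namespace IsModelSolution

variable {u : En n → ℝ → ℝ} {P : En n → ℝ → En n} {M : En n → ℝ → Matrix (Fin n) (Fin n) ℝ}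
  {D f : En n → ℝ → ℝ} {A : Matrix (Fin n) (Fin n) ℝ} {τ lam Λ γ : ℝ}

lemma volume_diff_le (h : IsModelSolution u P M D f A τ lam Λ γ) {E : Set (En n × ℝ)}
    (hE : MeasurableSet E) {N' : ℕ} (hN' : 1 ≤ N') (hEN : E ⊆ box n N') {V η : ℝ}
    (hV : 0 ≤ V)
    (hVE : ENNReal.ofReal V ≤ ∫⁻ z in E, ENNReal.ofReal (f z.1 z.2))
    (hη : (2 * N') ^ n * N' ^ 2 - V ≤ lam * η) :
    volume (box n N' \ E) ≤ ENNReal.ofReal η := by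
  have h1 := lintegral_inter_add_sdiff (μ := volume)
    (fun z : En n × ℝ => ENNReal.ofReal (f z.1 z.2)) (box n N') hE
  rw [inter_eq_self_of_subset_right hEN] at h1
  have h2 := h.lintegral_le N' hN'
  rw [← h1] at h2
  have h3 : ENNReal.ofReal lam * volume (box n N' \ E) ≤
      ∫⁻ z in box n N' \ E, ENNReal.ofReal (f z.1 z.2) := by
    rw [← setLIntegral_const]
    refine setLIntegral_mono' ((isCompact_box _).measurableSet.diff hE) fun z hz => ?_
    exact ENNReal.ofReal_le_ofReal (h.lam_le _ _ (mem_halfSpace.1 (box_subset_halfSpace _ hz.1)))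
  have h4 : ENNReal.ofReal V + ENNReal.ofReal lam * volume (box n N' \ E) ≤
      ENNReal.ofReal ((2 * N') ^ n * N' ^ 2) := (add_le_add hVE h3).trans h2
  have h5 : ENNReal.ofReal lam * volume (box n N' \ E) ≤ ENNReal.ofReal (lam * η) := by
    refine le_trans ?_ (ENNReal.ofReal_le_ofReal hη)
    rw [ENNReal.ofReal_sub _ hV]
    exact ENNReal.le_sub_of_add_le_left ENNReal.ofReal_ne_top h4
  rw [ENNReal.ofReal_mul h.lam_pos.le] at h5
  exact (ENNReal.mul_le_mul_iff_right (ENNReal.ofReal_pos.2 h.lam_pos).ne'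
    ENNReal.ofReal_ne_top).1 h5

/-- Outside a set of small density, the gradient of the increment of `u` along a period is
almost that of the quadratic profile, measured in the inverse Hessian metric. -/
lemma exists_gradient_set (h : IsModelSolution u P M D f A τ lam Λ γ) {e : En n}
    (he : ∀ x t, t ≤ 0 → f (x + e) t = f x t) {k ϵ : ℝ} (hk : 0 < k) (hϵ : 0 < ϵ) :
    ∃ N₀ : ℝ, ∀ N : ℝ, N₀ ≤ N → ∃ E : Set (En n × ℝ), IsCompact E ∧ E ⊆ halfSpace n ∧
      volume (box n N \ E) ≤ ENNReal.ofReal (ϵ * N ^ (n + 2)) ∧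
      ∀ z ∈ E, 2 * k * ((P (z.1 + e) z.2 - P z.1 z.2 - op A e).ofLp ⬝ᵥ
        (M z.1 z.2)⁻¹ *ᵥ (P (z.1 + e) z.2 - P z.1 z.2 - op A e).ofLp) ≤ n + 1 := by
  have hlam := h.lam_pos
  have hτ := h.τ_pos
  obtain ⟨κ, hκ, hκA⟩ := exists_mul_sq_le_inner_op h.posDef_A
  obtain ⟨κ', hκ', hprof⟩ := h.exists_profile_ge
  obtain ⟨μ, hμ0, hμ1, hμ⟩ := exists_widening n
    (show 0 < lam * ϵ / 2 / 2 ^ n by positivity)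
  obtain ⟨ν, hν0, hν⟩ : ∃ ν : ℝ, 0 < ν ∧ (ν ≤ κ / 8 ∧ ν ≤ τ / 2 ∧ ν ≤ κ' / 2 ∧
      ν ≤ κ / 4 * μ ^ 2 / (3 * n + 4) ∧ ν ≤ τ / 2 * μ ^ 2 / (3 * n + 4) ∧
      ν ≤ lam * ϵ / 2 / 2 ^ n / ((n + 1) / τ) ∧ ν ≤ 1 / ((n + 1) / τ)) := by
    refine ⟨min (κ / 8) (min (τ / 2) (min (κ' / 2) (min (κ / 4 * μ ^ 2 / (3 * n + 4))
      (min (τ / 2 * μ ^ 2 / (3 * n + 4)) (min (lam * ϵ / 2 / 2 ^ n / ((n + 1) / τ))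
        (1 / ((n + 1) / τ))))))), ?_, ?_⟩
    · simp only [lt_min_iff]
      refine ⟨by positivity, by positivity, by positivity, by positivity, by positivity,
        by positivity, by positivity⟩
    · simp only [← le_min_iff, le_refl]
  obtain ⟨hν1, hν2, hν3, hν4, hν5, hν6, hν7⟩ := hν
  rw [le_div_iff₀ (by positivity)] at hν4 hν5 hν6 hν7
  obtain ⟨σ, hσ, N₀, hbar⟩ := h.exists_barrier_close e hk hν0
  set c₁ : ℝ := (n + 1) / τ with hc₁
  have hc₁0 : 0 < c₁ := by positivity
  have hτc : τ * c₁ = n + 1 := by rw [hc₁]; field_simp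
  refine ⟨max N₀ (1 / μ), fun N hN => ?_⟩
  obtain ⟨hclose, hpos⟩ := hbar N ((le_max_left _ _).trans hN)
  have hμN : 1 ≤ μ * N := by
    have := (le_max_right _ _).trans hN
    rwa [div_le_iff₀' hμ0] at this
  have hN0 : 0 < N := by
    by_contra! hcon
    nlinarith
  have hN1 : 1 ≤ N := by nlinarith
  set Φ : En n → ℝ → ℝ := fun x t => -1 * u x t + k * (incr u A e x t + σ * N) ^ 2 with hΦ
  have hC21 := (h.hasC21.const_mul (-1)).add ((h.hasC21_incr e (σ * N)).sq.const_mul k)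
  set N' : ℕ := ⌈(1 + μ) * N⌉₊ with hN'
  have hle : (1 + μ) * N ≤ N' := Nat.le_ceil _
  have hlt : (N' : ℝ) ≤ (1 + 2 * μ) * N := by
    have := Nat.ceil_lt_add_one (show 0 ≤ (1 + μ) * N by positivity)
    linarith
  have hN'1 : 1 ≤ N' := by
    have : (1 : ℝ) ≤ N' := by nlinarith
    exact_mod_cast this
  have hQ : ∀ q ∈ contactParams A τ N (-N ^ 2) (-(c₁ * ν * N ^ 2)),
      ∃ x t, (x, t) ∈ box n ((1 + μ) * N) ∧ Φ x t - ⟪q.1, x⟫ = q.2 ∧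
        ∀ y s, s ≤ t → Φ y s - ⟪q.1, y⟫ ≤ q.2 := by
    rintro _ ⟨⟨y, s⟩, ⟨hy, hs1, hs2⟩, rfl⟩
    simp only at hy hs1 hs2
    have hyN := norm_le_of_mem_cube hy
    have hstart : 1 / 2 * ⟪y, op A y⟫ + τ * s ≤ Φ y 0 - ⟪-op A y, y⟫ := by
      have h1 := (abs_le.1 (hclose y 0 le_rfl)).1
      have h2 := profile_sub_inner h.symm_A τ y y 0
      rw [sub_self, map_zero, inner_zero_left] at h2
      have h3 : τ * s ≤ -((n + 1) * ν * N ^ 2) := by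
        calc τ * s ≤ τ * (-(c₁ * ν * N ^ 2)) := by gcongr
          _ = -((τ * c₁) * ν * N ^ 2) := by ring
          _ = _ := by rw [hτc]
      have h4 : ν * (‖y‖ ^ 2 - 0 + N ^ 2) ≤ ν * (n * N ^ 2 - 0 + N ^ 2) := by gcongr
      simp only [hΦ]
      linarith
    obtain ⟨x, t, ht, heq, hmax⟩ := exists_contact (C := ν * N ^ 2) (κ := κ' / 2)
      hC21.cont_fun (half_pos hκ') (fun x t ht => by
        have h1 := (abs_le.1 (hclose x t ht)).2
        have h2 := hprof x t ht
        have h3 : ν * (‖x‖ ^ 2 - t) ≤ κ' / 2 * (‖x‖ ^ 2 - t) := by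
          have : 0 ≤ ‖x‖ ^ 2 - t := by nlinarith [sq_nonneg ‖x‖]
          gcongr
        linarith) (-op A y) _ le_rfl hstart
    obtain ⟨k1, k2⟩ := contact_near h.symm_A hτ hκA hν0 hν1 hν2 hclose hy hs1 ht heq
      (hmax y t le_rfl)
    refine ⟨x, t, mem_box_of_near hμ0.le hy hs1 ht ?_ ?_, heq, hmax⟩
    · have k3 : κ / 4 * ‖x - y‖ ^ 2 ≤ κ / 4 * (μ * N) ^ 2 := by
        refine k1.trans ?_
        calc ν * ((3 * n + 4) * N ^ 2) = (ν * (3 * n + 4)) * N ^ 2 := by ring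
          _ ≤ (κ / 4 * μ ^ 2) * N ^ 2 := by gcongr
          _ = _ := by ring
      exact (sq_le_sq₀ (norm_nonneg _) (by positivity)).1
        (le_of_mul_le_mul_left k3 (by positivity))
    · have k3 : τ / 2 * (s - t) ≤ τ / 2 * (μ * N) ^ 2 := by
        refine k2.trans ?_
        calc ν * ((3 * n + 4) * N ^ 2) = (ν * (3 * n + 4)) * N ^ 2 := by ring
          _ ≤ (τ / 2 * μ ^ 2) * N ^ 2 := by gcongr
          _ = _ := by ring
      exact le_of_mul_le_mul_left k3 (by positivity)
  obtain ⟨E, hES, hEc, hEpos, hvol⟩ := hC21.exists_contactSet (isCompact_box ((1 + μ) * N))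
    (box_subset_halfSpace _) hQ
  have hcon : ∀ z ∈ E, _ ∧ _ := fun z hz => by
    have hzt : z.2 ≤ 0 := mem_halfSpace.1 (box_subset_halfSpace _ (hES hz))
    have hG := hpos z (box_subset_box (by positivity)
      (show (1 + μ) * N ≤ 2 * N by gcongr; linarith) (hES hz))
    exact h.contact_barrier he hk.le hG hzt (hEpos z hz).1 (hEpos z hz).2
  have hc₁ν : c₁ * ν ≤ 1 := by linarith
  have hvolE : ENNReal.ofReal ((2 * N) ^ n * (N ^ 2 * (1 - c₁ * ν))) ≤
      ∫⁻ z in E, ENNReal.ofReal (f z.1 z.2) := by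
    have h1 := le_volume_contactParams hτ h.τ_mul_det hN0.le
      (show -N ^ 2 ≤ -(c₁ * ν * N ^ 2) by nlinarith [sq_nonneg N])
    rw [show -(c₁ * ν * N ^ 2) - -N ^ 2 = N ^ 2 * (1 - c₁ * ν) by ring] at h1
    refine h1.trans (hvol.trans ?_)
    exact setLIntegral_mono' hEc.measurableSet fun z hz =>
      ENNReal.ofReal_le_ofReal (hcon z hz).1
  have hEN : E ⊆ box n N' := hES.trans (box_subset_box (by positivity) hle)
  refine ⟨E, hEc, hES.trans (box_subset_halfSpace _), ?_, fun z hz => (hcon z hz).2⟩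
  refine (measure_mono (sdiff_subset_sdiff_left (box_subset_box hN0.le ?_))).trans
    (h.volume_diff_le hEc.measurableSet hN'1 hEN ?_ hvolE ?_)
  · nlinarith
  · have : 0 ≤ 1 - c₁ * ν := by linarith
    positivity
  · have h1 : (2 * (N' : ℝ)) ^ n * N' ^ 2 ≤
        (2 * ((1 + 2 * μ) * N)) ^ n * ((1 + 2 * μ) * N) ^ 2 := by gcongr
    have h2 : (2 * ((1 + 2 * μ) * N)) ^ n * ((1 + 2 * μ) * N) ^ 2 =
        2 ^ n * (1 + 2 * μ) ^ (n + 2) * N ^ (n + 2) := by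
      rw [mul_pow, mul_pow, mul_pow, pow_add, pow_add]; ring
    have h3 : (2 * N) ^ n * (N ^ 2 * (1 - c₁ * ν)) = 2 ^ n * (1 - c₁ * ν) * N ^ (n + 2) := by
      rw [mul_pow, pow_add]; ring
    rw [h3]
    rw [h2] at h1
    have h4 : 2 ^ n * ((1 + 2 * μ) ^ (n + 2) - 1 + ν * c₁) ≤ lam * ϵ := by
      calc 2 ^ n * ((1 + 2 * μ) ^ (n + 2) - 1 + ν * c₁)
          ≤ 2 ^ n * (lam * ϵ / 2 / 2 ^ n + lam * ϵ / 2 / 2 ^ n) := by gcongr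
        _ = _ := by field_simp; ring
    have h5 := mul_le_mul_of_nonneg_right h4 (show 0 ≤ N ^ (n + 2) by positivity)
    linarith

end IsModelSolution

lemma volume_box {N : ℝ} (hN : 0 ≤ N) :
    volume (box n N) = ENNReal.ofReal (2 ^ n * N ^ (n + 2)) := by
  rw [box, Measure.volume_eq_prod, Measure.prod_prod, volume_cube, Real.volume_Icc,
    ← ENNReal.ofReal_pow (by positivity), ← ENNReal.ofReal_mul (by positivity)]
  congr 1
  rw [mul_pow, pow_add]; ring

instance : (volume : Measure (En n × ℝ)).IsAddRightInvariant := by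
  rw [Measure.volume_eq_prod]; infer_instance

lemma add_smul_mem_box {N r L : ℝ} {e : En n} (hL : 0 ≤ L) (hN : 0 ≤ N) (hr : |r| * ‖e‖ ≤ L)
    {z : En n × ℝ} (hz : z ∈ box n N) : (z.1 + r • e, z.2) ∈ box n (N + L) := by
  refine ⟨fun i => ?_, ?_, hz.2.2⟩
  · have h1 : |(r • e) i| ≤ ‖r • e‖ := by simpa using PiLp.norm_apply_le (r • e) i
    rw [norm_smul, Real.norm_eq_abs] at h1
    have h2 := hz.1 i
    have h3 := abs_add_le (z.1 i) ((r • e) i)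
    have h4 : (z.1 + r • e) i = z.1 i + (r • e) i := by simp
    rw [h4]; linarith
  · have := hz.2.1
    have h2 : N ^ 2 ≤ (N + L) ^ 2 := by gcongr; linarith
    show -(N + L) ^ 2 ≤ z.2
    linarith

namespace IsModelSolution

variable {u : En n → ℝ → ℝ} {P : En n → ℝ → En n} {M : En n → ℝ → Matrix (Fin n) (Fin n) ℝ}
  {D f : En n → ℝ → ℝ} {A : Matrix (Fin n) (Fin n) ℝ} {τ lam Λ γ : ℝ}

lemma exists_abs_le (h : IsModelSolution u P M D f A τ lam Λ γ) :
    ∃ C : ℝ, 0 < C ∧ ∀ x t, t ≤ 0 → |u x t| ≤ C * (‖x‖ ^ 2 - t + 1) := by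
  obtain ⟨C, hC0, hC⟩ := h.asymp_linear one_pos
  have hτ := h.τ_pos
  refine ⟨1 + C + ‖op A‖ + τ, by positivity, fun x t ht => ?_⟩
  have h1 := hC x t ht
  have h2 : |profile A τ x t| ≤ (‖op A‖ + τ) * (‖x‖ ^ 2 - t) := by
    have h3 : |⟪x, op A x⟫| ≤ ‖op A‖ * ‖x‖ ^ 2 := by
      refine (abs_real_inner_le_norm _ _).trans ?_
      have := (op A).le_opNorm x
      nlinarith [norm_nonneg x]
    have h4 : 0 ≤ ‖op A‖ * ‖x‖ ^ 2 := by positivity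
    have h5 : 0 ≤ τ * ‖x‖ ^ 2 := by positivity
    have h6 : 0 ≤ ‖op A‖ * (-t) := mul_nonneg (norm_nonneg _) (by linarith)
    have h7 : 0 ≤ τ * (-t) := mul_nonneg hτ.le (by linarith)
    rw [profile, abs_le]
    rw [abs_le] at h3
    constructor <;> linarith
  have h3 : |u x t| ≤ |u x t - profile A τ x t| + |profile A τ x t| := by
    simpa using abs_add_le (u x t - profile A τ x t) (profile A τ x t)
  have hρ : 0 ≤ ‖x‖ ^ 2 - t := by nlinarith [sq_nonneg ‖x‖]
  have h4 : 0 ≤ C * (‖x‖ ^ 2 - t) := by positivity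
  have h5 : 0 ≤ ‖op A‖ + τ := by positivity
  linarith

lemma hasDerivAt_inner_grad (h : IsModelSolution u P M D f A τ lam Λ γ) (e x : En n) {t : ℝ}
    (ht : t ≤ 0) (r : ℝ) :
    HasDerivAt (fun r : ℝ => ⟪e, P (x + r • e) t⟫) (⟪e, op (M (x + r • e) t) e⟫) r := by
  have h1 : HasDerivAt (fun r : ℝ => x + r • e) e r := by
    simpa using ((hasDerivAt_id r).smul_const e).const_add x
  have h2 := (h.hasC21.hess (x + r • e) t ht).comp_hasDerivAt r h1
  exact (innerSL ℝ e).hasFDerivAt.comp_hasDerivAt r h2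

lemma inner_op_hess_nonneg (h : IsModelSolution u P M D f A τ lam Λ γ) (e x : En n) {t : ℝ}
    (ht : t ≤ 0) : 0 ≤ ⟪e, op (M x t) e⟫ := by
  rw [inner_op]; simpa using (h.posDef x t ht).posSemidef.dotProduct_mulVec_nonneg e.ofLp

lemma continuous_inner_op_hess (h : IsModelSolution u P M D f A τ lam Λ γ) (e : En n) :
    Continuous fun z : En n × ℝ => ⟪e, op (M z.1 (min z.2 0)) e⟫ := by
  have h1 : Continuous fun z : En n × ℝ => M z.1 (min z.2 0) :=
    h.hasC21.cont_hess.comp_continuous (f := fun z : En n × ℝ => (z.1, min z.2 0))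
      (by fun_prop) fun z => mem_halfSpace.2 (min_le_right _ _)
  simp_rw [inner_op]
  exact continuous_const.dotProduct (h1.matrix_mulVec continuous_const)

lemma lintegral_inner_op_hess_le (h : IsModelSolution u P M D f A τ lam Λ γ) (e x : En n)
    {t : ℝ} (ht : t ≤ 0) {N : ℝ} (hN : 0 ≤ N) :
    ∫⁻ r in Icc 0 N, ENNReal.ofReal ⟪e, op (M (x + r • e) t) e⟫ =
      ENNReal.ofReal (⟪e, P (x + N • e) t⟫ - ⟪e, P x t⟫) := by
  have hcont : Continuous fun r : ℝ => ⟪e, op (M (x + r • e) t) e⟫ := by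
    have := (h.continuous_inner_op_hess e).comp
      (show Continuous fun r : ℝ => (x + r • e, t) by fun_prop)
    simpa [Function.comp_def, min_eq_left ht] using this
  have h1 := intervalIntegral.integral_eq_sub_of_hasDerivAt (a := 0) (b := N)
    (fun r _ => h.hasDerivAt_inner_grad e x ht r) (hcont.intervalIntegrable _ _)
  rw [zero_smul, add_zero, intervalIntegral.integral_of_le hN,
    ← integral_Icc_eq_integral_Ioc] at h1
  rw [← h1, ofReal_integral_eq_lintegral_ofReal]
  · exact hcont.continuousOn.integrableOn_compact isCompact_Icc
  · exact ae_of_all _ fun r => h.inner_op_hess_nonneg e _ ht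

lemma exists_inner_grad_sub_le (h : IsModelSolution u P M D f A τ lam Λ γ) (e : En n) :
    ∃ C : ℝ, 0 < C ∧ ∀ N : ℝ, 1 ≤ N → ∀ z ∈ box n ((1 + ‖e‖) * N),
      ⟪e, P (z.1 + N • e) z.2⟫ - ⟪e, P z.1 z.2⟫ ≤ C * N := by
  obtain ⟨C, hC0, hC⟩ := h.exists_abs_le
  refine ⟨4 * C * (2 * (n + 1) * (1 + ‖e‖) ^ 2 + 8 * ‖e‖ ^ 2 + 1), by positivity,
    fun N hN z hz => ?_⟩
  have ht : z.2 ≤ 0 := hz.2.2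
  have hN0 : 0 < N := by linarith
  set K : ℝ := C * ((2 * (n + 1) * (1 + ‖e‖) ^ 2 + 8 * ‖e‖ ^ 2 + 1) * N ^ 2) with hK
  have hu : ∀ s : ℝ, s ^ 2 ≤ 4 * N ^ 2 → |u (z.1 + s • e) z.2| ≤ K := by
    intro s hs
    refine (hC _ _ ht).trans ?_
    have h1 := norm_add_smul_sq_le z.1 e s
    have h2 := norm_le_of_mem_cube hz.1
    have h3 : -((1 + ‖e‖) * N) ^ 2 ≤ z.2 := hz.2.1
    have h4 : 2 * s ^ 2 * ‖e‖ ^ 2 ≤ 2 * (4 * N ^ 2) * ‖e‖ ^ 2 := by gcongr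
    have h5 : 1 ≤ N ^ 2 := by nlinarith
    have h6 : 0 ≤ ((1 + ‖e‖) * N) ^ 2 := by positivity
    rw [hK]
    refine mul_le_mul_of_nonneg_left ?_ hC0.le
    linarith
  have a1 := h.hasC21.add_inner_le_of_convexOn ht (h.conv _ ht) (z.1 + N • e) (z.1 + (2 * N) • e)
  have a2 := h.hasC21.add_inner_le_of_convexOn ht (h.conv _ ht) z.1 (z.1 + (-N) • e)
  rw [show z.1 + (2 * N) • e - (z.1 + N • e) = N • e by module, inner_smul_right,
    real_inner_comm] at a1
  rw [show z.1 + (-N) • e - z.1 = (-N) • e by module, inner_smul_right, real_inner_comm] at a2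
  have b1 := abs_le.1 (hu (2 * N) (by nlinarith))
  have b2 := abs_le.1 (hu N (by nlinarith))
  have b3 := abs_le.1 (hu (-N) (by nlinarith))
  have b4 := abs_le.1 (hu 0 (by nlinarith))
  rw [zero_smul, add_zero] at b4
  have : N * (⟪e, P (z.1 + N • e) z.2⟫ - ⟪e, P z.1 z.2⟫) ≤ 4 * K := by linarith
  refine le_of_mul_le_mul_left (this.trans (le_of_eq ?_)) hN0
  rw [hK]; ring

/-- The pure second derivatives of `u` are bounded outside a set of small density. -/
lemma exists_hess_bound (h : IsModelSolution u P M D f A τ lam Λ γ) (e : En n) {ϵ : ℝ}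
    (hϵ : 0 < ϵ) : ∃ B : ℝ, 0 < B ∧ ∀ N : ℝ, 1 ≤ N →
      volume {z ∈ box n N | B < ⟪e, op (M z.1 z.2) e⟫} ≤ ENNReal.ofReal (ϵ * N ^ (n + 2)) := by
  obtain ⟨C, hC0, hC⟩ := h.exists_inner_grad_sub_le e
  set K : ℝ := C * (2 ^ n * (1 + ‖e‖) ^ (n + 2)) with hK
  have hK0 : 0 < K := by positivity
  set U : En n × ℝ → ℝ≥0∞ := fun z => ENNReal.ofReal ⟪e, op (M z.1 (min z.2 0)) e⟫ with hU
  have hUc : Continuous U := ENNReal.continuous_ofReal.comp (h.continuous_inner_op_hess e)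
  refine ⟨K / ϵ, by positivity, fun N hN => ?_⟩
  have hN0 : 0 < N := by linarith
  set N₂ : ℝ := (1 + ‖e‖) * N with hN₂
  have hshift : ∀ r ∈ Icc 0 N, ∫⁻ z in box n N, U z ≤
      ∫⁻ z in box n N₂, U (z.1 + r • e, z.2) := by
    intro r hr
    have hmp : MeasurePreserving (fun z : En n × ℝ => z + ((r • e : En n), (0:ℝ))) volume volume :=
      measurePreserving_add_right volume _
    have hme : MeasurableEmbedding (fun z : En n × ℝ => z + ((r • e : En n), (0:ℝ))) :=
      measurableEmbedding_addRight _
    rw [← hmp.setLIntegral_comp_preimage_emb hme]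
    have heq : ∀ z : En n × ℝ, z + ((r • e : En n), (0:ℝ)) = (z.1 + r • e, z.2) := by
      intro z; ext <;> simp
    simp only [heq]
    refine lintegral_mono_set fun z hz => ?_
    have hz' : (z.1 + r • e, z.2) ∈ box n N := hz
    have := add_smul_mem_box (r := -r) (e := e) (L := ‖e‖ * N) (by positivity) hN0.le (by
      rw [abs_neg, abs_of_nonneg hr.1, mul_comm]; gcongr; exact hr.2) hz'
    simp only [neg_smul, add_neg_cancel_right] at this
    convert this using 1
    rw [hN₂]; congr 1; ring
  have hmain : ENNReal.ofReal N * ∫⁻ z in box n N, U z ≤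
      ENNReal.ofReal N * ENNReal.ofReal (K * N ^ (n + 2)) := by
    calc ENNReal.ofReal N * ∫⁻ z in box n N, U z
        = ∫⁻ _r in Icc 0 N, ∫⁻ z in box n N, U z := by
          rw [setLIntegral_const, Real.volume_Icc, sub_zero, mul_comm]
      _ ≤ ∫⁻ r in Icc 0 N, ∫⁻ z in box n N₂, U (z.1 + r • e, z.2) :=
          setLIntegral_mono' measurableSet_Icc hshift
      _ = ∫⁻ z in box n N₂, ∫⁻ r in Icc 0 N, U (z.1 + r • e, z.2) := by
          refine lintegral_lintegral_swap ?_
          refine (Continuous.measurable ?_).aemeasurable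
          exact hUc.comp (by fun_prop)
      _ ≤ ∫⁻ _z in box n N₂, ENNReal.ofReal (C * N) := by
          refine setLIntegral_mono' (isCompact_box _).measurableSet fun z hz => ?_
          have ht : z.2 ≤ 0 := hz.2.2
          simp only [hU, min_eq_left ht]
          rw [h.lintegral_inner_op_hess_le e z.1 ht hN0.le]
          exact ENNReal.ofReal_le_ofReal (hC N hN z hz)
      _ = _ := by
          rw [setLIntegral_const, volume_box (by positivity), ← ENNReal.ofReal_mul (by positivity),
            ← ENNReal.ofReal_mul hN0.le]
          congr 1
          rw [hN₂, hK, mul_pow]; ring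
  have hval : ∫⁻ z in box n N, U z ≤ ENNReal.ofReal (K * N ^ (n + 2)) :=
    (ENNReal.mul_le_mul_iff_right (ENNReal.ofReal_pos.2 hN0).ne' ENNReal.ofReal_ne_top).1 hmain
  have hmarkov := mul_meas_ge_le_lintegral (μ := volume.restrict (box n N)) hUc.measurable
    (ENNReal.ofReal (K / ϵ))
  have hset : volume {z ∈ box n N | K / ϵ < ⟪e, op (M z.1 z.2) e⟫} ≤
      volume.restrict (box n N) {z | ENNReal.ofReal (K / ϵ) ≤ U z} := by
    rw [Measure.restrict_apply' (isCompact_box _).measurableSet]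
    refine measure_mono fun z hz => ⟨?_, hz.1⟩
    have ht : z.2 ≤ 0 := hz.1.2.2
    simp only [mem_ofPred_eq, hU, min_eq_left ht]
    exact ENNReal.ofReal_le_ofReal hz.2.le
  have hfin : ENNReal.ofReal (K / ϵ) * volume {z ∈ box n N | K / ϵ < ⟪e, op (M z.1 z.2) e⟫} ≤
      ENNReal.ofReal (K / ϵ) * ENNReal.ofReal (ϵ * N ^ (n + 2)) := by
    refine le_trans (by gcongr) ((hmarkov.trans hval).trans (le_of_eq ?_))
    rw [← ENNReal.ofReal_mul (by positivity)]
    congr 1; field_simp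
  exact (ENNReal.mul_le_mul_iff_right (ENNReal.ofReal_pos.2 (by positivity)).ne'
    ENNReal.ofReal_ne_top).1 hfin

end IsModelSolution

lemma second_difference_le {ψ φ : ℝ → ℝ} (hsub : ∀ s r, ψ s + φ s * (r - s) ≤ ψ r) {m : ℕ}
    (hm : 0 < m) {a : ℝ} (h : ∀ i : ℕ, i ≤ m → φ (i / m) ≤ φ (i / m - 1) + a) :
    ψ 1 + ψ (-1) - 2 * ψ 0 ≤ a + a / m := by
  have hm0 : (0 : ℝ) < m := by exact_mod_cast hm
  have h1 : ∑ i ∈ Finset.range m, (ψ ((i + 1 : ℕ) / m) - ψ (i / m)) = ψ 1 - ψ 0 := by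
    rw [Finset.sum_range_sub (fun i : ℕ => ψ (i / m))]
    simp [hm0.ne']
  have h2 : ∑ i ∈ Finset.range m, (ψ ((i + 1 : ℕ) / m - 1) - ψ (i / m - 1)) =
      ψ 0 - ψ (-1) := by
    rw [Finset.sum_range_sub (fun i : ℕ => ψ (i / m - 1))]
    simp [hm0.ne']
  have h3 : ∑ i ∈ Finset.range m, (φ ((i + 1 : ℕ) / m - 1) - φ (i / m - 1)) =
      φ 0 - φ (-1) := by
    rw [Finset.sum_range_sub (fun i : ℕ => φ (i / m - 1))]
    simp [hm0.ne']
  have h4 : φ 0 - φ (-1) ≤ a := by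
    have := h 0 (Nat.zero_le _)
    simp only [Nat.cast_zero, zero_div, zero_sub] at this
    linarith
  have key : ∀ i ∈ Finset.range m,
      (ψ ((i + 1 : ℕ) / m) - ψ (i / m)) - (ψ ((i + 1 : ℕ) / m - 1) - ψ (i / m - 1)) ≤
        (φ ((i + 1 : ℕ) / m - 1) - φ (i / m - 1)) / m + a / m := by
    intro i hi
    have hi' : i + 1 ≤ m := Finset.mem_range.1 hi
    have a1 := hsub ((i + 1 : ℕ) / m) (i / m)
    have a2 := hsub (i / m - 1) ((i + 1 : ℕ) / m - 1)
    have a3 := h (i + 1) hi'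
    have e1 : (i / m : ℝ) - ((i + 1 : ℕ) / m) = -(1 / m) := by push_cast; field_simp; ring
    have e2 : ((i + 1 : ℕ) / m - 1 : ℝ) - (i / m - 1) = 1 / m := by push_cast; field_simp; ring
    rw [e1] at a1
    rw [e2] at a2
    have a4 : φ ((i + 1 : ℕ) / m) * (1 / m) ≤ (φ ((i + 1 : ℕ) / m - 1) + a) * (1 / m) := by
      gcongr
    have e3 : (φ ((i + 1 : ℕ) / m - 1) - φ (i / m - 1)) / m + a / m =
      (φ ((i + 1 : ℕ) / m - 1) + a) * (1 / m) - φ (i / m - 1) * (1 / m) := by ring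
    rw [e3]
    linarith
  have hsum := Finset.sum_le_sum key
  rw [Finset.sum_sub_distrib, h1, h2, Finset.sum_add_distrib, ← Finset.sum_div, h3,
    Finset.sum_const, Finset.card_range, nsmul_eq_mul, mul_div_cancel₀ _ hm0.ne'] at hsum
  have : (φ 0 - φ (-1)) / m ≤ a / m := by gcongr
  linarith

namespace IsModelSolution

variable {u : En n → ℝ → ℝ} {P : En n → ℝ → En n} {M : En n → ℝ → Matrix (Fin n) (Fin n) ℝ}
  {D f : En n → ℝ → ℝ} {A : Matrix (Fin n) (Fin n) ℝ} {τ lam Λ γ : ℝ}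

lemma inner_grad_sub_le (h : IsModelSolution u P M D f A τ lam Λ γ) {e x : En n} {t B θ : ℝ}
    (ht : t ≤ 0) (hB : 0 < B) (hθ : 0 < θ) (hee : ⟪e, op (M x t) e⟫ ≤ B)
    (hg : 2 * ((n + 1) * B / (2 * θ ^ 2)) * ((P (x + e) t - P x t - op A e).ofLp ⬝ᵥ
        (M x t)⁻¹ *ᵥ (P (x + e) t - P x t - op A e).ofLp) ≤ n + 1) :
    ⟪e, P (x + e) t⟫ ≤ ⟪e, P x t⟫ + (⟪e, op A e⟫ + θ) := by
  set g := P (x + e) t - P x t - op A e with hgdef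
  set q := g.ofLp ⬝ᵥ (M x t)⁻¹ *ᵥ g.ofLp with hq
  have hq0 : 0 ≤ q := by
    simpa using (h.posDef x t ht).inv.posSemidef.dotProduct_mulVec_nonneg g.ofLp
  have h1 := sq_dotProduct_le_of_posDef (h.posDef x t ht) e.ofLp g.ofLp
  rw [← inner_op, ← hq] at h1
  have h2 : e.ofLp ⬝ᵥ g.ofLp = ⟪e, g⟫ := by
    rw [EuclideanSpace.inner_eq_star_dotProduct, dotProduct_comm]; simp
  rw [h2] at h1
  have h3 : B * q ≤ θ ^ 2 := by
    have hn : (0:ℝ) < n + 1 := by positivity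
    have : (n + 1) * (B * q) ≤ (n + 1) * θ ^ 2 := by
      have h4 : 2 * ((n + 1) * B / (2 * θ ^ 2)) * q = (n + 1) * (B * q) / θ ^ 2 := by
        field_simp
      rw [h4, div_le_iff₀ (by positivity)] at hg
      exact hg
    exact le_of_mul_le_mul_left this hn
  have h4 : ⟪e, g⟫ ^ 2 ≤ θ ^ 2 := by
    have : ⟪e, op (M x t) e⟫ * q ≤ B * q := by gcongr
    linarith
  have h5 := abs_le_of_sq_le_sq h4 hθ.le
  rw [hgdef, inner_sub_right, inner_sub_right] at h5
  linarith [(abs_le.1 h5).2]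

/-- The second differences of `u` exceed those of the quadratic profile by a fixed amount only
on a set of small density. -/
lemma volume_second_difference_gt_le (h : IsModelSolution u P M D f A τ lam Λ γ) {e : En n}
    (he : ∀ x t, t ≤ 0 → f (x + e) t = f x t) {θ ϵ : ℝ} (hθ : 0 < θ) (hϵ : 0 < ϵ) :
    ∃ N₀ : ℝ, ∀ N : ℝ, N₀ ≤ N →
      volume {z ∈ box n N | ⟪e, op A e⟫ + θ <
        u (z.1 + e) z.2 + u (z.1 - e) z.2 - 2 * u z.1 z.2} ≤
          ENNReal.ofReal (ϵ * N ^ (n + 2)) := by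
  set c := ⟪e, op A e⟫ with hc
  have hc0 : 0 ≤ c := h.inner_op_nonneg e
  obtain ⟨m, hm0, hm⟩ : ∃ m : ℕ, 0 < m ∧ (c + θ / 2) / m ≤ θ / 2 := by
    obtain ⟨m, hm⟩ := exists_nat_gt ((c + θ / 2) / (θ / 2))
    have hm0 : (0:ℝ) < m := lt_of_le_of_lt (by positivity) hm
    refine ⟨m, by exact_mod_cast hm0, ?_⟩
    rw [div_lt_iff₀ (by positivity)] at hm
    rw [div_le_iff₀ hm0]; linarith
  set ϵ₁ : ℝ := ϵ / ((m + 1) * 2 ^ (n + 3)) with hϵ₁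
  have hϵ₁0 : 0 < ϵ₁ := by positivity
  obtain ⟨B, hB0, hB⟩ := h.exists_hess_bound e hϵ₁0
  have hk : 0 < (n + 1) * B / (2 * (θ / 2) ^ 2) := by positivity
  obtain ⟨N₀, hN₀⟩ := h.exists_gradient_set he hk hϵ₁0
  refine ⟨max N₀ (1 + ‖e‖), fun N hN => ?_⟩
  have hN1 : 1 + ‖e‖ ≤ N := (le_max_right _ _).trans hN
  have hN1' : 1 ≤ N := by linarith [norm_nonneg e]
  obtain ⟨E, -, -, hEvol, hE⟩ := hN₀ (2 * N) (by linarith [le_max_left N₀ (1 + ‖e‖)])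
  set T : Set (En n × ℝ) := (box n (2 * N) \ E) ∪
    {z ∈ box n (2 * N) | B < ⟪e, op (M z.1 z.2) e⟫} with hT
  have hTvol : volume T ≤ ENNReal.ofReal (ϵ / (m + 1) * N ^ (n + 2)) := by
    refine (measure_union_le _ _).trans ((add_le_add hEvol (hB (2 * N) (by linarith))).trans ?_)
    rw [← ENNReal.ofReal_add (by positivity) (by positivity)]
    refine ENNReal.ofReal_le_ofReal (le_of_eq ?_)
    rw [hϵ₁, mul_pow, pow_succ 2 (n + 2)]; field_simp; ring
  have hsub : {z ∈ box n N | c + θ < u (z.1 + e) z.2 + u (z.1 - e) z.2 - 2 * u z.1 z.2} ⊆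
      ⋃ i ∈ Finset.range (m + 1),
        (fun z : En n × ℝ => z + (((i / m - 1 : ℝ) • e : En n), (0:ℝ))) ⁻¹' T := by
    rintro ⟨x, t⟩ ⟨hz, hbig⟩
    by_contra hcon
    simp only [mem_iUnion, not_exists, mem_preimage, Prod.mk_add_mk, add_zero] at hcon
    have ht : t ≤ 0 := hz.2.2
    have hgood : ∀ i : ℕ, i ≤ m →
        ⟪e, P (x + (i / m : ℝ) • e) t⟫ ≤ ⟪e, P (x + (i / m - 1 : ℝ) • e) t⟫ + (c + θ / 2) := by
      intro i hi
      have hbox : (x + (i / m - 1 : ℝ) • e, t) ∈ box n (2 * N) := by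
        have hm' : (0:ℝ) < m := by exact_mod_cast hm0
        have h1 : (i / m : ℝ) ≤ 1 := by
          rw [div_le_one hm']; exact_mod_cast hi
        have h2 : (0:ℝ) ≤ i / m := by positivity
        have := add_smul_mem_box (r := (i / m - 1 : ℝ)) (e := e) (L := N) (by linarith)
          (by linarith) (by
            have : |(i / m - 1 : ℝ)| ≤ 1 := abs_le.2 ⟨by linarith, by linarith⟩
            nlinarith [norm_nonneg e]) hz
        rwa [two_mul]
      have hnT := hcon i (Finset.mem_range.2 (by omega))
      rw [hT, mem_union, not_or] at hnT
      have hzE : (x + (i / m - 1 : ℝ) • e, t) ∈ E := by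
        by_contra hcon'
        exact hnT.1 ⟨hbox, hcon'⟩
      have hee : ⟪e, op (M (x + (i / m - 1 : ℝ) • e) t) e⟫ ≤ B := by
        by_contra! hcon'
        exact hnT.2 ⟨hbox, hcon'⟩
      have hg := hE _ hzE
      dsimp only at hg
      have := h.inner_grad_sub_le (x := x + (i / m - 1 : ℝ) • e) ht hB0 (half_pos hθ) hee hg
      rwa [show x + (i / m - 1 : ℝ) • e + e = x + (i / m : ℝ) • e by module] at this
    have := second_difference_le (ψ := fun s => u (x + s • e) t)
      (φ := fun s => ⟪e, P (x + s • e) t⟫) (fun s r => by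
        have h1 := h.hasC21.add_inner_le_of_convexOn ht (h.conv t ht) (x + s • e) (x + r • e)
        rw [show x + r • e - (x + s • e) = (r - s) • e by module, inner_smul_right,
          real_inner_comm] at h1
        linarith) hm0 hgood
    simp only [one_smul, neg_smul, zero_smul, add_zero, ← sub_eq_add_neg] at this
    simp only at hbig
    linarith
  refine (measure_mono hsub).trans ((measure_biUnion_finset_le _ _).trans ?_)
  simp only [measure_preimage_add_right]
  rw [Finset.sum_const, Finset.card_range, nsmul_eq_mul]
  calc ((m + 1 : ℕ) : ℝ≥0∞) * volume T
      ≤ ENNReal.ofReal (m + 1) * ENNReal.ofReal (ϵ / (m + 1) * N ^ (n + 2)) := by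
        rw [← ENNReal.ofReal_natCast, Nat.cast_add, Nat.cast_one]
        gcongr
    _ = _ := by
        rw [← ENNReal.ofReal_mul (by positivity)]
        congr 1; field_simp

end IsModelSolution

/-- A sequence with at most geometric growth of ratio `q` grows infinitely often by a factor at
most `2 * q`. -/
lemma exists_le_mul_of_le_geometric {m : ℕ → ℝ} {C q θ : ℝ} (hq : 1 ≤ q) (hθ : 0 < θ) {k₀ : ℕ}
    (hub : ∀ k, m k ≤ C * q ^ k) (hlb : ∀ k, k₀ ≤ k → θ ≤ m k) :
    ∃ k, k₀ ≤ k ∧ m (k + 1) ≤ 2 * q * m k := by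
  by_contra! hcon
  have hq0 : 0 < q := by linarith
  have h1 : ∀ j : ℕ, (2 * q) ^ j * θ ≤ m (k₀ + j) := by
    intro j
    induction j with
    | zero => simpa using hlb k₀ le_rfl
    | succ j ih =>
      have h2 := hcon (k₀ + j) (Nat.le_add_right _ _)
      have h3 : 2 * q * ((2 * q) ^ j * θ) ≤ 2 * q * m (k₀ + j) := by gcongr
      rw [pow_succ, ← add_assoc]
      linarith
  obtain ⟨j, hj⟩ := pow_unbounded_of_one_lt (C * q ^ k₀ / θ) (one_lt_two (α := ℝ))
  have h2 := (h1 j).trans (hub (k₀ + j))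
  rw [div_lt_iff₀ hθ] at hj
  rw [mul_pow, pow_add] at h2
  have h3 : q ^ j * (2 ^ j * θ) ≤ q ^ j * (C * q ^ k₀) := by linarith
  have := le_of_mul_le_mul_left h3 (by positivity)
  linarith

/-- Young inequality for powers less than one. -/
lemma mul_rpow_le_add {C a y γ : ℝ} (hC : 0 < C) (ha : 0 < a) (hy : 0 < y) (hγ0 : 0 < γ)
    (hγ : γ < 1) : C * y ^ γ ≤ a * y + C * (C / a) ^ (γ / (1 - γ)) := by
  have hγ' : 0 < 1 - γ := by linarith
  rcases le_total (C * y ^ γ) (a * y) with h | h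
  · have : 0 ≤ C * (C / a) ^ (γ / (1 - γ)) := by positivity
    linarith
  · have h1 : y ^ (1 - γ) ≤ C / a := by
      rw [Real.rpow_sub hy, Real.rpow_one, div_le_div_iff₀ (by positivity) ha]
      linarith
    have h2 : y ^ γ ≤ (C / a) ^ (γ / (1 - γ)) := by
      have h3 := Real.rpow_le_rpow (by positivity) h1 (show 0 ≤ γ / (1 - γ) by positivity)
      rwa [← Real.rpow_mul hy.le, mul_div_cancel₀ _ hγ'.ne'] at h3
    have h3 : C * y ^ γ ≤ C * (C / a) ^ (γ / (1 - γ)) := by gcongr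
    have : 0 ≤ a * y := by positivity
    linarith

/-- The excess of the second difference of `u` over that of the quadratic profile. -/
def excess (u : En n → ℝ → ℝ) (A : Matrix (Fin n) (Fin n) ℝ) (e x : En n) (t : ℝ) : ℝ :=
  u (x + e) t + u (x - e) t - 2 * u x t - ⟪e, op A e⟫

namespace IsModelSolution

variable {u : En n → ℝ → ℝ} {P : En n → ℝ → En n} {M : En n → ℝ → Matrix (Fin n) (Fin n) ℝ}
  {D f : En n → ℝ → ℝ} {A : Matrix (Fin n) (Fin n) ℝ} {τ lam Λ γ : ℝ}

lemma hasC21_excess (h : IsModelSolution u P M D f A τ lam Λ γ) (e : En n) (β : ℝ) :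
    HasC21 (fun x t => excess u A e x t - β * u x t)
      (fun x t => P (x + e) t + P (x - e) t - (2 + β) • P x t)
      (fun x t => M (x + e) t + M (x - e) t - (2 + β) • M x t)
      (fun x t => D (x + e) t + D (x - e) t - (2 + β) * D x t) := by
  have := (((h.hasC21.translate e).add (h.hasC21.translate (-e))).add
    (h.hasC21.const_mul (-(2 + β)))).add (HasC21.affine 0 (-⟪e, op A e⟫))
  convert this using 1
  · funext x t
    rw [excess, inner_zero_left, sub_eq_add_neg x e]; ring
  · funext x t
    rw [sub_eq_add_neg x e]; module
  · funext x t
    rw [sub_eq_add_neg x e]; module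
  · funext x t
    rw [sub_eq_add_neg x e]; ring

lemma contact_excess (h : IsModelSolution u P M D f A τ lam Λ γ) {e : En n}
    (he : ∀ x t, t ≤ 0 → f (x + e) t = f x t) {β : ℝ}
    {x : En n} {t : ℝ} (ht : t ≤ 0)
    (hζ : 0 ≤ D (x + e) t + D (x - e) t - (2 + β) * D x t)
    (hZ : (-(M (x + e) t + M (x - e) t - (2 + β) • M x t)).PosSemidef) :
    (D (x + e) t + D (x - e) t - (2 + β) * D x t) *
      (-(M (x + e) t + M (x - e) t - (2 + β) • M x t)).det ≤ β ^ (n + 1) * f x t := by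
  have hp : 0 < -D x t := by linarith [h.time_neg x t ht]
  have h1 := h.le_trace_translate he (x := x) ht
  have h2 := h.le_trace_translate (e := -e) (fun x t ht => by
    have := he (x + -e) t ht
    rw [neg_add_cancel_right] at this
    exact this.symm) (x := x) ht
  rw [← sub_eq_add_neg] at h2
  have h3 := h.inv_mul_self_trace (x := x) ht
  rw [← h.eqn x t ht]
  refine mul_det_le_of_trace_le (h.posDef x t ht) hZ hp hζ ?_
  have h4 : ((M x t)⁻¹ * -(M (x + e) t + M (x - e) t - (2 + β) • M x t)).trace =
      (2 + β) * n - ((M x t)⁻¹ * M (x + e) t).trace - ((M x t)⁻¹ * M (x - e) t).trace := by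
    rw [mul_neg, mul_sub, mul_add, trace_neg, trace_sub, trace_add, Matrix.mul_smul, trace_smul, h3,
      smul_eq_mul]
    ring
  have h5 : (D (x + e) t + D (x - e) t - (2 + β) * D x t) / (-D x t) =
      (2 + β) - (-D (x + e) t) / (-D x t) - (-D (x - e) t) / (-D x t) := by
    have hD : D x t ≠ 0 := (h.time_neg x t ht).ne
    field_simp; ring
  rw [h4, h5]
  linarith

lemma exists_excess_le (h : IsModelSolution u P M D f A τ lam Λ γ) (e : En n) :
    ∃ C : ℝ, 0 < C ∧ ∀ x t, t ≤ 0 → excess u A e x t ≤ C * (1 + (‖x‖ ^ 2 - t)) ^ γ := by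
  obtain ⟨C, hC⟩ := h.asymp
  have hγ := h.γ_pos
  set L : ℝ := 2 + 2 * ‖e‖ ^ 2 with hL
  have hL0 : 0 < L := by positivity
  refine ⟨(|C| + 1) * (2 * L ^ γ + 2), by positivity, fun x t ht => ?_⟩
  have hρ : 0 ≤ ‖x‖ ^ 2 - t := by nlinarith [sq_nonneg ‖x‖]
  have hC' : ∀ x, |u x t - profile A τ x t| ≤ (|C| + 1) * (1 + (‖x‖ ^ 2 - t)) ^ γ := by
    intro x
    have hρ : 0 ≤ ‖x‖ ^ 2 - t := by nlinarith [sq_nonneg ‖x‖]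
    refine (hC x t ht).trans ?_
    gcongr
    linarith [le_abs_self C]
  have hs : ∀ s : ℝ, s ^ 2 = 1 → |u (x + s • e) t - profile A τ (x + s • e) t| ≤
      (|C| + 1) * (L ^ γ * (1 + (‖x‖ ^ 2 - t)) ^ γ) := by
    intro s hs
    refine (hC' _).trans ?_
    rw [← Real.mul_rpow hL0.le (by positivity)]
    have h1 := norm_add_smul_sq_le x e s
    have h0 : 0 ≤ ‖x + s • e‖ ^ 2 - t := by nlinarith [sq_nonneg ‖x + s • e‖]
    gcongr
    rw [hs] at h1
    have h2 : 0 ≤ 2 * ‖e‖ ^ 2 * (‖x‖ ^ 2 - t) := by positivity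
    rw [hL]; nlinarith
  have a1 := abs_le.1 (hs 1 (by norm_num))
  have a2 := abs_le.1 (hs (-1) (by norm_num))
  have a3 := abs_le.1 (hC' x)
  have b1 := profile_add h.symm_A τ x e 1 t
  have b2 := profile_add h.symm_A τ x e (-1) t
  rw [one_smul] at a1 b1
  rw [neg_one_smul, ← sub_eq_add_neg] at a2 b2
  rw [excess]
  linarith

/-- Growth of the suprema of `excess - βu` along `β = 2⁻ᵏ`. -/
lemma exists_isLUB_excess_sub (h : IsModelSolution u P M D f A τ lam Λ γ) (e : En n) :
    ∃ (m : ℕ → ℝ) (C q : ℝ), 1 ≤ q ∧ (∀ k, m k ≤ C * q ^ k) ∧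
      ∀ k, IsLUB ((fun z : En n × ℝ => excess u A e z.1 z.2 - (1 / 2) ^ k * u z.1 z.2) ''
        halfSpace n) (m k) := by
  obtain ⟨Ch, hCh0, hCh⟩ := h.exists_excess_le e
  obtain ⟨κ, C₅, hκ, hC₅, hu⟩ := h.exists_ge
  have hγ0 := h.γ_pos
  have hγ := h.γ_lt
  have hγ' : 0 < 1 - γ := by linarith
  set p : ℝ := γ / (1 - γ) with hp
  have hp0 : 0 < p := by positivity
  set q : ℝ := 2 ^ p with hq
  have hq1 : 1 ≤ q := Real.one_le_rpow one_le_two hp0.le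
  set C : ℝ := κ + C₅ + Ch * (Ch / κ) ^ p with hC
  have hbound : ∀ k : ℕ, ∀ z ∈ halfSpace n,
      excess u A e z.1 z.2 - (1 / 2) ^ k * u z.1 z.2 ≤ C * q ^ k := by
    intro k z hz
    have ht := mem_halfSpace.1 hz
    set β : ℝ := (1 / 2) ^ k with hβ
    have hβ0 : 0 < β := by positivity
    have hβ1 : β ≤ 1 := pow_le_one₀ (by norm_num) (by norm_num)
    have hρ : 0 ≤ ‖z.1‖ ^ 2 - z.2 := by nlinarith [sq_nonneg ‖z.1‖]
    have h1 := hCh z.1 z.2 ht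
    have h2 := mul_le_mul_of_nonneg_left (hu z.1 z.2 ht) hβ0.le
    have h3 := mul_rpow_le_add (y := 1 + (‖z.1‖ ^ 2 - z.2)) hCh0
      (show 0 < β * κ by positivity) (by positivity) hγ0 hγ
    have h4 : (Ch / (β * κ)) ^ (γ / (1 - γ)) = (Ch / κ) ^ p * q ^ k := by
      have : Ch / (β * κ) = Ch / κ * 2 ^ k := by
        rw [hβ, one_div, inv_pow]; field_simp
      rw [this, Real.mul_rpow (by positivity) (by positivity), ← hp, hq, ← Real.rpow_natCast,
        ← Real.rpow_natCast, ← Real.rpow_mul (by norm_num), ← Real.rpow_mul (by norm_num),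
        mul_comm p]
    rw [h4] at h3
    have hqk : 1 ≤ q ^ k := one_le_pow₀ hq1
    have h5 : β * κ + β * C₅ ≤ (κ + C₅) * q ^ k := by
      have : β * κ + β * C₅ ≤ κ + C₅ := by nlinarith
      have h6 : (κ + C₅) * 1 ≤ (κ + C₅) * q ^ k := by gcongr
      linarith
    rw [hC]
    linarith
  refine ⟨fun k => sSup ((fun z : En n × ℝ =>
    excess u A e z.1 z.2 - (1 / 2) ^ k * u z.1 z.2) '' halfSpace n), C, q, hq1, ?_, ?_⟩
  · intro k
    refine csSup_le (Nonempty.image _ ⟨(0, 0), mem_halfSpace.2 le_rfl⟩) ?_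
    rintro _ ⟨z, hz, rfl⟩
    exact hbound k z hz
  · intro k
    refine isLUB_csSup (Nonempty.image _ ⟨(0, 0), mem_halfSpace.2 le_rfl⟩) ⟨C * q ^ k, ?_⟩
    rintro _ ⟨z, hz, rfl⟩
    exact hbound k z hz

/-- Aleksandrov–Bakelman–Pucci estimate for `excess - βu`. -/
lemma volume_contact_excess_le (h : IsModelSolution u P M D f A τ lam Λ γ) {e : En n}
    (he : ∀ x t, t ≤ 0 → f (x + e) t = f x t) {κ C₅ β m B s θ ϵ : ℝ} (hκ : 0 < κ)
    (hu : ∀ x t, t ≤ 0 → κ * (‖x‖ ^ 2 - t) - C₅ ≤ u x t) (hβ : 0 < β)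
    (hm : 0 < m) (hβC : β * C₅ ≤ m / 8) (hθ : θ < m / 4) (hB : 1 ≤ B) (hs : 0 < s)
    (hsβ : β * s ^ 2 = 2 * (B + 1) / κ * m)
    (hlub : IsLUB ((fun z : En n × ℝ => excess u A e z.1 z.2 - β * u z.1 z.2) '' halfSpace n) m)
    (hhalf : ∀ x t, t ≤ 0 → excess u A e x t - β / 2 * u x t ≤ B * m) (hϵ : 0 ≤ ϵ)
    (hvol : volume {z ∈ box n s | ⟪e, op A e⟫ + θ <
      u (z.1 + e) z.2 + u (z.1 - e) z.2 - 2 * u z.1 z.2} ≤ ENNReal.ofReal (ϵ * s ^ (n + 2))) :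
    (m / (8 * s)) ^ n * (volume (Metric.ball (0 : En n) 1)).toReal * (m / 4) ≤
      β ^ (n + 1) * Λ * (ϵ * s ^ (n + 2)) := by
  have hC21 := h.hasC21_excess e β
  have hΛ : 0 ≤ Λ := by
    linarith [h.lam_pos, h.lam_le 0 0 le_rfl, h.le_Λ 0 0 le_rfl]
  have hdecay : ∀ x t, t ≤ 0 → s ^ 2 * (excess u A e x t - β * u x t) ≤
      (B + 1) * m * (s ^ 2 - (‖x‖ ^ 2 - t)) := by
    intro x t ht
    have h1 := hhalf x t ht
    have h2 := mul_le_mul_of_nonneg_left (hu x t ht) (half_pos hβ).le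
    have h3 : excess u A e x t - β * u x t ≤ (B + 1) * m - β / 2 * κ * (‖x‖ ^ 2 - t) := by
      linarith
    have h4 : s ^ 2 * (β / 2 * κ) = (B + 1) * m := by
      have : s ^ 2 * (β / 2 * κ) = (β * s ^ 2) * κ / 2 := by ring
      rw [this, hsβ]; field_simp
    calc s ^ 2 * (excess u A e x t - β * u x t)
        ≤ s ^ 2 * ((B + 1) * m - β / 2 * κ * (‖x‖ ^ 2 - t)) := by gcongr
      _ = s ^ 2 * ((B + 1) * m) - s ^ 2 * (β / 2 * κ) * (‖x‖ ^ 2 - t) := by ring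
      _ = _ := by rw [h4]; ring
  obtain ⟨⟨x₀, t₀⟩, ht₀, hX₀⟩ : ∃ z ∈ halfSpace n,
      7 / 8 * m < excess u A e z.1 z.2 - β * u z.1 z.2 := by
    obtain ⟨_, ⟨z, hz, rfl⟩, h1⟩ := (lt_isLUB_iff hlub).1 (show 7 / 8 * m < m by linarith)
    exact ⟨z, hz, h1⟩
  rw [mem_halfSpace] at ht₀
  simp only at ht₀ hX₀
  have hx₀ : ‖x₀‖ ≤ s := by
    have h1 := hdecay x₀ t₀ ht₀
    have h2 : 0 < s ^ 2 * (excess u A e x₀ t₀ - β * u x₀ t₀) := by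
      have : 0 < excess u A e x₀ t₀ - β * u x₀ t₀ := by linarith
      positivity
    have h3 : 0 < s ^ 2 - (‖x₀‖ ^ 2 - t₀) :=
      pos_of_mul_pos_right (h2.trans_le h1) (by positivity)
    exact abs_le_of_sq_le_sq (a := ‖x₀‖) (by linarith) hs.le |>.trans' (le_abs_self _)
  set r : ℝ := m / (8 * s) with hr
  have hr0 : 0 < r := by positivity
  have hrs : r * s = m / 8 := by rw [hr]; field_simp
  set S : Set (En n × ℝ) := {z ∈ box n s | ⟪e, op A e⟫ + m / 4 ≤
      u (z.1 + e) z.2 + u (z.1 - e) z.2 - 2 * u z.1 z.2} with hS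
  have hSc : IsCompact S := by
    refine (isCompact_box s).of_isClosed_subset ?_ (fun z hz => hz.1)
    refine (isCompact_box s).isClosed.isClosed_le continuousOn_const ?_
    have h1 := ((h.hasC21_excess e 0).cont_fun.add
      (continuousOn_const (c := ⟪e, op A e⟫))).mono (box_subset_halfSpace s)
    refine h1.congr fun z _ => ?_
    simp only [excess, Pi.add_apply]; ring
  have hQ : ∀ w ∈ Metric.closedBall (0 : En n) r ×ˢ Icc (m / 2) (3 / 4 * m), ∃ x t, (x, t) ∈ S ∧
      (excess u A e x t - β * u x t) - ⟪w.1, x⟫ = w.2 ∧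
      ∀ y s, s ≤ t → (excess u A e y s - β * u y s) - ⟪w.1, y⟫ ≤ w.2 := by
    rintro ⟨p, η⟩ ⟨hp, hη1, hη2⟩
    rw [mem_closedBall_zero_iff] at hp
    simp only at hp hη1 hη2
    have hpx : ∀ x : En n, |⟪p, x⟫| ≤ r * ‖x‖ := fun x =>
      (abs_real_inner_le_norm _ _).trans (by gcongr)
    have hstart : η ≤ (excess u A e x₀ t₀ - β * u x₀ t₀) - ⟪p, x₀⟫ := by
      have h1 := (abs_le.1 (hpx x₀)).2
      have h2 : r * ‖x₀‖ ≤ r * s := by gcongr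
      linarith
    obtain ⟨x, t, ht, heq, hmax⟩ := exists_contact (C := (B + 1) * m)
      (κ := (B + 1) * m / s ^ 2) hC21.cont_fun (by positivity) (fun x t ht => by
        have h1 := hdecay x t ht
        have h2 : (B + 1) * m - (B + 1) * m / s ^ 2 * (‖x‖ ^ 2 - t) =
          ((B + 1) * m * (s ^ 2 - (‖x‖ ^ 2 - t))) / s ^ 2 := by field_simp
        rw [h2, le_div_iff₀' (by positivity)]
        exact h1) p η ht₀ hstart
    have hd := hdecay x t ht
    have hpx' := abs_le.1 (hpx x)
    have hρ : ‖x‖ ^ 2 - t ≤ s ^ 2 := by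
      by_contra! hcon
      set ρ := ‖x‖ ^ 2 - t with hρdef
      set w := √ρ with hw
      have hw2 : w ^ 2 = ρ := Real.sq_sqrt (by nlinarith)
      have hw0 : 0 ≤ w := Real.sqrt_nonneg _
      have hxw : ‖x‖ ≤ w := Real.le_sqrt_of_sq_le (by linarith)
      have hsw : s < w := lt_of_pow_lt_pow_left₀ 2 hw0 (by linarith)
      have h1 : m / 2 - r * w ≤ excess u A e x t - β * u x t := by
        have : r * ‖x‖ ≤ r * w := by gcongr
        linarith
      have h2 : s ^ 2 * (m / 2 - r * w) ≤ (B + 1) * m * (s ^ 2 - w ^ 2) := by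
        rw [hw2]; exact le_trans (by gcongr) hd
      have h3 : (B + 1) * m * (s ^ 2 - w ^ 2) ≤ m * (s ^ 2 - w ^ 2) := by
        have : 0 ≤ B * m * (w ^ 2 - s ^ 2) :=
          mul_nonneg (by positivity) (by nlinarith)
        linarith
      have h4 : s ^ 2 * (m / 2 - r * w) = m * (s ^ 2 / 2 - s * w / 8) := by
        have : s ^ 2 * (m / 2 - r * w) = s ^ 2 * m / 2 - (r * s) * s * w := by ring
        rw [this, hrs]; ring
      have h5 : m * (s ^ 2 / 2 - s * w / 8) ≤ m * (s ^ 2 - w ^ 2) := by linarith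
      have h6 := le_of_mul_le_mul_left h5 hm
      have h7 : s * w < w * w := mul_lt_mul_of_pos_right hsw (hs.trans hsw)
      have h8 : s * s < s * w := by gcongr
      have h9 : 0 < s * s := by positivity
      linarith [sq s, sq w]
    have hxs : ‖x‖ ≤ s := (sq_le_sq₀ (norm_nonneg _) hs.le).1 (by linarith)
    refine ⟨x, t, ⟨⟨fun i => ?_, ?_, ht⟩, ?_⟩, heq, hmax⟩
    · have h2 : |x i| ≤ ‖x‖ := by simpa using PiLp.norm_apply_le x i
      linarith
    · show -s ^ 2 ≤ t
      nlinarith [sq_nonneg ‖x‖]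
    · have h1 : r * ‖x‖ ≤ r * s := by gcongr
      have h2 := mul_le_mul_of_nonneg_left (hu x t ht) hβ.le
      have h3 : 0 ≤ β * (κ * (‖x‖ ^ 2 - t)) := by
        have : 0 ≤ ‖x‖ ^ 2 - t := by nlinarith [sq_nonneg ‖x‖]
        positivity
      have h4 : m / 4 ≤ excess u A e x t := by linarith
      rw [excess] at h4
      simp only
      linarith
  obtain ⟨E, hES, hEc, hEpos, hEvol⟩ := hC21.exists_contactSet hSc
    (fun z hz => box_subset_halfSpace _ hz.1) hQ
  have hQvol : volume (Metric.closedBall (0 : En n) r ×ˢ Icc (m / 2) (3 / 4 * m)) =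
      ENNReal.ofReal (r ^ n * (volume (Metric.ball (0 : En n) 1)).toReal * (m / 4)) := by
    rw [Measure.volume_eq_prod, Measure.prod_prod, Measure.addHaar_closedBall _ _ hr0.le,
      Real.volume_Icc, finrank_euclideanSpace_fin, ENNReal.ofReal_mul (by positivity),
      ENNReal.ofReal_mul (by positivity), ENNReal.ofReal_toReal measure_ball_lt_top.ne]
    congr 2; ring
  rw [hQvol] at hEvol
  have hle : ∫⁻ z in E, ENNReal.ofReal ((D (z.1 + e) z.2 + D (z.1 - e) z.2 - (2 + β) * D z.1 z.2) *
      (-(M (z.1 + e) z.2 + M (z.1 - e) z.2 - (2 + β) • M z.1 z.2)).det) ≤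
      ENNReal.ofReal (β ^ (n + 1) * Λ * (ϵ * s ^ (n + 2))) := by
    calc _ ≤ ∫⁻ _z in E, ENNReal.ofReal (β ^ (n + 1) * Λ) := by
          refine setLIntegral_mono' hEc.measurableSet fun z hz => ENNReal.ofReal_le_ofReal ?_
          have ht : z.2 ≤ 0 := mem_halfSpace.1 (box_subset_halfSpace _ (hES hz).1)
          refine (h.contact_excess he ht (hEpos z hz).1 (hEpos z hz).2).trans ?_
          have := h.le_Λ z.1 z.2 ht
          gcongr
      _ = ENNReal.ofReal (β ^ (n + 1) * Λ) * volume E := setLIntegral_const _ _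
      _ ≤ ENNReal.ofReal (β ^ (n + 1) * Λ) * ENNReal.ofReal (ϵ * s ^ (n + 2)) := by
          gcongr
          refine le_trans (measure_mono ?_) hvol
          intro z hz
          have := (hES hz).2
          exact ⟨(hES hz).1, by linarith⟩
      _ = _ := (ENNReal.ofReal_mul (by positivity)).symm
  exact (ENNReal.ofReal_le_ofReal_iff (by positivity)).1 (hEvol.trans hle)

/-- Second differences along periods never exceed those of the quadratic profile. -/
lemma excess_nonpos (h : IsModelSolution u P M D f A τ lam Λ γ) {e : En n}
    (he : ∀ x t, t ≤ 0 → f (x + e) t = f x t) {x : En n} {t : ℝ} (ht : t ≤ 0) :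
    excess u A e x t ≤ 0 := by
  by_contra! hpos
  set θ := excess u A e x t with hθ
  obtain ⟨κ, C₅, hκ, hC₅, hu⟩ := h.exists_ge
  obtain ⟨m, C, q, hq, hmC, hm⟩ := h.exists_isLUB_excess_sub e
  have hΛ : 0 < Λ := h.lam_pos.trans_le ((h.lam_le 0 0 le_rfl).trans (h.le_Λ 0 0 le_rfl))
  set K := 2 * (2 * q + 1) / κ with hK
  have hK0 : 0 < K := by positivity
  set ω := (volume (Metric.ball (0 : En n) 1)).toReal with hω
  have hω0 : 0 < ω :=
    ENNReal.toReal_pos (Metric.measure_ball_pos _ _ one_pos).ne' measure_ball_lt_top.ne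
  set ϵ := ω / (8 * 8 ^ n * K ^ (n + 1) * Λ) with hϵ
  have hϵ0 : 0 < ϵ := by positivity
  obtain ⟨N₀, hN₀⟩ := h.volume_second_difference_gt_le he (θ := θ / 16) (by positivity) hϵ0
  obtain ⟨k₀, hk₀⟩ := pow_unbounded_of_one_lt
    (max (2 * |u x t| / θ) (max (16 * C₅ / θ) (2 * N₀ ^ 2 / (K * θ)))) (one_lt_two (α := ℝ))
  have hlarge : ∀ k, k₀ ≤ k → (1 / 2 : ℝ) ^ k * |u x t| ≤ θ / 2 ∧
      (1 / 2 : ℝ) ^ k * C₅ ≤ θ / 16 ∧ (1 / 2 : ℝ) ^ k * N₀ ^ 2 ≤ K * θ / 2 := by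
    intro k hk
    have h1 : (2 : ℝ) ^ k₀ ≤ 2 ^ k := pow_le_pow_right₀ one_le_two hk
    have h2 := hk₀.trans_le h1
    rw [max_lt_iff, max_lt_iff, div_lt_iff₀ hpos, div_lt_iff₀ hpos,
      div_lt_iff₀ (by positivity)] at h2
    obtain ⟨h3, h4, h5⟩ := h2
    have h6 : ∀ a : ℝ, (1 / 2 : ℝ) ^ k * a = a / 2 ^ k := fun a => by
      rw [one_div, inv_pow, div_eq_inv_mul]
    simp only [h6, div_le_iff₀ (show (0 : ℝ) < 2 ^ k by positivity)]
    refine ⟨?_, ?_, ?_⟩ <;> linarith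
  have hmθ : ∀ k, k₀ ≤ k → θ / 2 ≤ m k := by
    intro k hk
    have h1 : θ - (1 / 2) ^ k * u x t ≤ m k := (hm k).1 ⟨(x, t), mem_halfSpace.2 ht, rfl⟩
    have h2 : (1 / 2 : ℝ) ^ k * u x t ≤ (1 / 2) ^ k * |u x t| := by
      gcongr; exact le_abs_self _
    linarith [(hlarge k hk).1]
  obtain ⟨k, hk, hstep⟩ := exists_le_mul_of_le_geometric hq (half_pos hpos) hmC hmθ
  obtain ⟨-, hkC, hkN⟩ := hlarge k hk
  have hmk := hmθ k hk
  set β : ℝ := (1 / 2) ^ k with hβ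
  have hβ0 : 0 < β := by positivity
  have hmk0 : 0 < m k := by linarith
  set s := √(K * m k / β) with hs
  have hs0 : 0 < s := Real.sqrt_pos.2 (by positivity)
  have hs2 : β * s ^ 2 = K * m k := by
    rw [hs, Real.sq_sqrt (by positivity)]; field_simp
  have hsN : N₀ ≤ s := by
    refine Real.le_sqrt_of_sq_le ?_
    rw [le_div_iff₀' hβ0]
    have : K * (θ / 2) ≤ K * m k := by gcongr
    linarith
  have key := h.volume_contact_excess_le he hκ hu hβ0 hmk0 (by linarith) (θ := θ / 16)
    (by linarith) (B := 2 * q) (by linarith) hs0 hs2 (hm k) (fun y r hr => by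
      have h1 : excess u A e y r - (1 / 2) ^ (k + 1) * u y r ≤ m (k + 1) :=
        (hm (k + 1)).1 ⟨(y, r), mem_halfSpace.2 hr, rfl⟩
      rw [pow_succ, ← hβ] at h1
      rw [div_eq_mul_one_div β 2]
      exact h1.trans hstep) hϵ0.le (hN₀ s hsN)
  rw [← hω] at key
  have h1 : β ^ (n + 1) * Λ * (ϵ * s ^ (n + 2)) * s ^ n = (K * m k) ^ (n + 1) * Λ * ϵ := by
    rw [← hs2]; ring
  have h2 : (m k / (8 * s)) ^ n * ω * (m k / 4) * s ^ n = m k ^ (n + 1) * ω / (4 * 8 ^ n) := by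
    rw [div_pow, mul_pow, pow_succ]; field_simp
  have h3 : (K * m k) ^ (n + 1) * Λ * ϵ = m k ^ (n + 1) * ω / (8 * 8 ^ n) := by
    rw [hϵ, mul_pow]; field_simp
  have h4 := mul_le_mul_of_nonneg_right key (pow_nonneg hs0.le n)
  rw [h1, h2, h3] at h4
  have h5 : 0 < m k ^ (n + 1) * ω / (8 * 8 ^ n) := by positivity
  have h6 : m k ^ (n + 1) * ω / (4 * 8 ^ n) = 2 * (m k ^ (n + 1) * ω / (8 * 8 ^ n)) := by
    field_simp; norm_num
  linarith

end IsModelSolution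

lemma add_neg_le_of_second_difference_le {a : ℝ → ℝ} {b : ℝ}
    (h : ∀ s, a (s + 1) + a (s - 1) - 2 * a s ≤ b) (k : ℕ) :
    a k + a (-k) - 2 * a 0 ≤ k ^ 2 * b := by
  have hstep : ∀ k : ℕ, (a (k + 1) + a (-(k + 1))) - (a k + a (-k)) ≤ (2 * k + 1) * b := by
    intro k
    induction k with
    | zero => have := h 0; norm_num at this ⊢; linarith
    | succ k ih =>
      have h1 := h (k + 1)
      have h2 := h (-(k + 1))
      rw [show (k + 1 - 1 : ℝ) = k by ring] at h1
      rw [show (-(k + 1) + 1 : ℝ) = -k by ring,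
        show (-(k + 1) - 1 : ℝ) = -(k + 1 + 1) by ring] at h2
      push_cast
      linarith
  induction k with
  | zero => norm_num; linarith
  | succ k ih =>
    have := hstep k
    push_cast
    linarith

namespace IsModelSolution

variable {u : En n → ℝ → ℝ} {P : En n → ℝ → En n} {M : En n → ℝ → Matrix (Fin n) (Fin n) ℝ}
  {D f : En n → ℝ → ℝ} {A : Matrix (Fin n) (Fin n) ℝ} {τ lam Λ γ : ℝ}

/-- A uniform upper bound for the second differences bounds those of the quadratic profile. -/
lemma inner_op_le_of_second_difference_le (h : IsModelSolution u P M D f A τ lam Λ γ) {e : En n}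
    {b : ℝ} (hb : ∀ x, u (x + e) 0 + u (x - e) 0 - 2 * u x 0 ≤ b) : ⟪e, op A e⟫ ≤ b := by
  by_contra! hlt
  set δ := ⟪e, op A e⟫ - b with hδ
  have hδ0 : 0 < δ := by linarith
  set ν := δ / (4 * (‖e‖ ^ 2 + 1)) with hν
  obtain ⟨C, hC0, hC⟩ := h.asymp_linear (ν := ν) (by positivity)
  have hνe : ν * ‖e‖ ^ 2 ≤ δ / 4 := by
    rw [hν, div_mul_eq_mul_div, div_le_iff₀ (by positivity)]
    linarith
  have hray : ∀ s : ℝ, s ^ 2 / 2 * ⟪e, op A e⟫ - s ^ 2 * (δ / 4) - C ≤ u (s • e) 0 := by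
    intro s
    have h1 := (abs_le.1 (hC (s • e) 0 le_rfl)).1
    have h2 : profile A τ (s • e) 0 = s ^ 2 / 2 * ⟪e, op A e⟫ := by
      have := profile_add h.symm_A τ 0 e s 0
      simpa [profile] using this
    have h3 : ν * (‖s • e‖ ^ 2 - 0) ≤ s ^ 2 * (δ / 4) := by
      rw [norm_smul, mul_pow, Real.norm_eq_abs, sq_abs, sub_zero]
      calc ν * (s ^ 2 * ‖e‖ ^ 2) = s ^ 2 * (ν * ‖e‖ ^ 2) := by ring
        _ ≤ _ := by gcongr
    linarith
  obtain ⟨k, hk⟩ := exists_nat_gt (max 1 ((2 * (2 * C + 2 * u 0 0)) / δ))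
  obtain ⟨hk1, hk2⟩ := max_lt_iff.1 hk
  have htel := add_neg_le_of_second_difference_le (a := fun s => u (s • e) 0) (b := b)
    (fun s => by simpa only [add_smul, sub_smul, one_smul] using hb (s • e)) k
  simp only [zero_smul] at htel
  have h1 := hray k
  have h2 := hray (-k)
  rw [neg_sq] at h2
  have hkk : (k : ℝ) ≤ (k : ℝ) ^ 2 := by nlinarith
  have h3 : (k : ℝ) * δ ≤ (k : ℝ) ^ 2 * δ := by gcongr
  rw [div_lt_iff₀ hδ0] at hk2
  have h4 : (k : ℝ) ^ 2 * δ = (k : ℝ) ^ 2 * ⟪e, op A e⟫ - (k : ℝ) ^ 2 * b := by rw [hδ]; ring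
  linarith

end IsModelSolution

/-- The quadratic expansion outside a bounded set extends to the whole half-space. -/
lemma exists_abs_sub_profile_le {u : En n → ℝ → ℝ}
    (hu : ContinuousOn (fun z : En n × ℝ => u z.1 z.2) (halfSpace n))
    {A : Matrix (Fin n) (Fin n) ℝ} {τ C₀ γ : ℝ} (hC₀ : 0 < C₀) (hγ : 0 < γ)
    (hasym : ∀ (x : En n) (t : ℝ), t ≤ 0 → C₀ ≤ ‖x‖ ^ 2 - t →
      |u x t - profile A τ x t| ≤ C₀ * (‖x‖ ^ 2 - t) ^ γ) :
    ∃ C : ℝ, ∀ x t, t ≤ 0 → |u x t - profile A τ x t| ≤ C * (1 + (‖x‖ ^ 2 - t)) ^ γ := by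
  have hcont : ContinuousOn (fun z : En n × ℝ => u z.1 z.2 - profile A τ z.1 z.2)
      {z | z.2 ≤ 0 ∧ ‖z.1‖ ^ 2 - z.2 ≤ C₀} := by
    refine (hu.mono fun z hz => mem_halfSpace.2 hz.1).sub (Continuous.continuousOn ?_)
    unfold profile
    fun_prop
  obtain ⟨B, hB⟩ := (isCompact_parabolic n C₀).exists_bound_of_continuousOn hcont
  refine ⟨max B C₀, fun x t ht => ?_⟩
  have hρ : 0 ≤ ‖x‖ ^ 2 - t := by nlinarith [sq_nonneg ‖x‖]
  rcases le_total C₀ (‖x‖ ^ 2 - t) with h1 | h1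
  · refine (hasym x t ht h1).trans ?_
    gcongr
    · exact le_max_right _ _
    · linarith
  · have h2 : |u x t - profile A τ x t| ≤ B := hB (x, t) ⟨ht, h1⟩
    have h3 : 1 ≤ (1 + (‖x‖ ^ 2 - t)) ^ γ := Real.one_le_rpow (by linarith) hγ.le
    have h4 : 0 ≤ max B C₀ := hC₀.le.trans (le_max_right _ _)
    exact (h2.trans (le_max_left _ C₀)).trans (le_mul_of_one_le_right h4 h3)

end PMA

/-- the exact supremum of the second-order difference quotients. -/
theorem stmt16
    (n : ℕ) (hn : 1 ≤ n) (α : ℝ) (hα : α ∈ Set.Ioo (0:ℝ) 1)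
    (f₁ : En n → ℝ) (f₂ : ℝ → ℝ)
    (hf₁pos : ∀ x, 0 < f₁ x) (hf₂pos : ∀ t : ℝ, t ≤ 0 → 0 < f₂ t)
    (hf₁hold : ∃ K : NNReal, HolderWith K α.toNNReal f₁)
    (hf₂hold : ∃ K : NNReal, HolderOnWith K (α/2).toNNReal f₂ (Set.Iic 0))
    (hf₁per : ∀ (x : En n) (i : Fin n), f₁ (x + EuclideanSpace.single i 1) = f₁ x)
    (hf₂per : ∀ t : ℝ, t ≤ 0 → f₂ (t - 1) = f₂ t)
    (hf₁avg : ∫ x in {x : En n | ∀ i, x i ∈ Set.Icc (0:ℝ) 1}, f₁ x = 1)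
    (hf₂avg : ∫ t in Set.Icc (-1:ℝ) 0, f₂ t = 1)
    (lam Λ : ℝ) (hlam : 0 < lam)
    (hfbdd : ∀ (x : En n) (t : ℝ), t ≤ 0 → lam ≤ f₁ x * f₂ t ∧ f₁ x * f₂ t ≤ Λ)
    (u : En n → ℝ → ℝ)
    (hureg : PMA.IsC2kOn 1 u (PMA.halfSpace n))
    (huconv : PMA.ParabolicallyConvexOn (PMA.halfSpace n) u)
    (m₁ m₂ : ℝ) (hm₁ : 0 < m₁) (hm₂ : 0 < m₂)
    (hut : ∀ (x : En n) (t : ℝ), t ≤ 0 →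
      m₁ ≤ -PMA.timeDeriv u x t ∧ -PMA.timeDeriv u x t ≤ m₂)
    (heq : ∀ (x : En n) (t : ℝ), t ≤ 0 →
      -PMA.timeDeriv u x t * (PMA.spaceHess u x t).det = f₁ x * f₂ t)
    (hu0 : u 0 0 = 0) (hDu0 : PMA.spaceGrad u 0 0 = 0)
    (τ : ℝ) (hτ : τ ∈ Set.Icc m₁ m₂)
    (A : Matrix (Fin n) (Fin n) ℝ) (hAsymm : A.IsSymm) (hApos : A.PosDef)
    (hdetA : τ * A.det = 1)
    (ε C₀ : ℝ) (hε : ε ∈ Set.Ioo (0:ℝ) 1) (hC₀ : 0 < C₀)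
    (hasym : ∀ (x : En n) (t : ℝ), t ≤ 0 → C₀ ≤ ‖x‖^2 - t →
      |u x t - ((1/2) * PMA.quadForm A x - τ * t)| ≤ C₀ * (‖x‖^2 - t) ^ ((4-ε)/4))
    :
    ∀ e : En n, (∀ i, ∃ k : ℤ, e i = (k : ℝ)) → e ≠ 0 →
      IsLUB {d : ℝ | ∃ (x : En n) (t : ℝ), t ≤ 0 ∧ d = PMA.sdq u e x t}
        (PMA.quadForm A e / ‖e‖^2) := by
  intro e hei he0
  have hτ0 : 0 < τ := hm₁.trans_le hτ.1
  have hC21 := hureg.hasC21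
  have hconv : ∀ t ≤ 0, ConvexOn ℝ univ fun x => u x t := by
    intro t ht
    have h1 := huconv.1 t
    rwa [show {x : En n | (x, t) ∈ PMA.halfSpace n} = univ from
      eq_univ_of_forall fun x => PMA.mem_halfSpace.2 ht] at h1
  obtain ⟨K₁, hK₁⟩ := hf₁hold
  obtain ⟨K₂, hK₂⟩ := hf₂hold
  have hf₁c : Continuous f₁ := hK₁.continuous (Real.toNNReal_pos.2 hα.1)
  have hf₂c : ContinuousOn f₂ (Iic 0) :=
    hK₂.continuousOn (Real.toNNReal_pos.2 (half_pos hα.1))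
  have hγ : 0 < (4 - ε) / 4 := by linarith [hε.2]
  have hmodel : PMA.IsModelSolution u (PMA.spaceGrad u) (PMA.spaceHess u) (PMA.timeDeriv u)
      (fun x t => f₁ x * f₂ t) A τ lam Λ ((4 - ε) / 4) :=
    { hasC21 := hC21
      conv := hconv
      posDef := fun x t ht => by
        refine (hC21.posSemidef_of_convexOn ht (hconv t ht) x).posDef_iff_isUnit.2 ?_
        rw [Matrix.isUnit_iff_isUnit_det, isUnit_iff_ne_zero]
        intro h0
        have h1 := heq x t ht
        rw [h0, mul_zero] at h1
        linarith [(hfbdd x t ht).1]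
      time_neg := fun x t ht => by linarith [(hut x t ht).1]
      eqn := heq
      lam_pos := hlam
      lam_le := fun x t ht => (hfbdd x t ht).1
      le_Λ := fun x t ht => (hfbdd x t ht).2
      lintegral_le := fun N hN =>
        PMA.setLIntegral_box_le hf₁pos hf₁c hf₁per hf₁avg hf₂pos hf₂c hf₂per hf₂avg hN
      posDef_A := hApos
      symm_A := hAsymm
      τ_pos := hτ0
      τ_mul_det := hdetA
      γ_pos := hγ
      γ_lt := by linarith [hε.1]
      asymp := PMA.exists_abs_sub_profile_le hC21.cont_fun hC₀ hγ fun x t ht hx => by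
        simpa only [PMA.profile, ← PMA.quadForm_eq_inner_op] using hasym x t ht hx }
  have he2 : 0 < ‖e‖ ^ 2 := by positivity
  rw [PMA.quadForm_eq_inner_op]
  refine ⟨?_, fun b hb => ?_⟩
  · rintro _ ⟨x, t, ht, rfl⟩
    have h1 := hmodel.excess_nonpos (e := e)
      (fun y r _ => by rw [PMA.periodic_of_forall_int hf₁per hei y]) (x := x) ht
    rw [PMA.excess] at h1
    rw [PMA.sdq]
    gcongr
    linarith
  · rw [div_le_iff₀ he2]
    refine hmodel.inner_op_le_of_second_difference_le fun x => ?_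
    rw [← div_le_iff₀ he2]
    exact hb ⟨x, 0, le_rfl, rfl⟩
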